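/- Let k be a finite field of characteristic p ≥ 5 and let n ≥ 2. Then H^0(GL(n,k), Λ²(gl_n)) = 0, H^1(GL(n,k), Λ²(gl_n)) = 0, and H^2(GL(n,k), Λ²(gl_n)) is 2-dimensional over k, where Λ²(gl_n) denotes the second exterior power of the adjoint representation gl_n. -/

import Mathlib

open scoped MatrixGroups TensorProduct

noncomputable section

/-- The adjoint (conjugation) representation of `GL(n,k)` on `gl_n`. -/
def glConj (k : Type) [Field k] (n : ℕ) :
    Representation k (GL (Fin n) k) (Matrix (Fin n) (Fin n) k) where
  toFun g :=
    { toFun := fun x => (g : Matrix (Fin n) (Fin n) k) * x * (↑g⁻¹ : Matrix (Fin n) (Fin n) k)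
      map_add' := fun x y => by noncomm_ring
      map_smul' := fun c x => by simp [Matrix.smul_mul, Matrix.mul_smul] }
  map_one' := by ext x; simp
  map_mul' g h := by
    ext x
    simp [Matrix.mul_assoc]

variable (k : Type) [Field k] {G : Type} [Group G]
variable (V : Type) [AddCommGroup V] [Module k V]

/-- The `m`-th tensor power of a representation (diagonal action). -/
def tpowRep (m : ℕ) (ρ : Representation k G V) :
    Representation k G (⨂[k] (_ : Fin m), V) :=
  PiTensorProduct.mapMonoidHom.comp (Pi.monoidHom fun _ => ρ)

lemma tpowRep_apply (m : ℕ) (ρ : Representation k G V) (g : G) (f : Fin m → V) :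
    tpowRep k V m ρ g (PiTensorProduct.tprod k f)
      = PiTensorProduct.tprod k (fun i => ρ g (f i)) := by
  exact PiTensorProduct.map_tprod _ _

/-- The subspace of the `m`-th tensor power by which one quotients to obtain
the `m`-th symmetric power. -/
def symPowSub (m : ℕ) : Submodule k (⨂[k] (_ : Fin m), V) :=
  Submodule.span k {z | ∃ (σ : Equiv.Perm (Fin m)) (f : Fin m → V),
    z = PiTensorProduct.tprod k f - PiTensorProduct.tprod k (f ∘ σ)}

/-- The `m`-th symmetric power of a `k`-vector space. -/
abbrev SymPow (m : ℕ) := (⨂[k] (_ : Fin m), V) ⧸ symPowSub k V m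

/-- The `m`-th symmetric power of a representation. -/
def symPowRep (m : ℕ) (ρ : Representation k G V) :
    Representation k G (SymPow k V m) where
  toFun g := Submodule.mapQ _ _ (tpowRep k V m ρ g) (by
    rw [symPowSub, Submodule.span_le]
    rintro z ⟨σ, f, rfl⟩
    simp only [SetLike.mem_coe, Submodule.mem_comap, map_sub, tpowRep_apply]
    refine Submodule.subset_span ⟨σ, fun i => ρ g (f i), ?_⟩
    simp [Function.comp_def])
  map_one' := by
    refine Submodule.linearMap_qext _ ?_
    refine PiTensorProduct.ext ?_
    ext f
    simp [Submodule.mapQ_apply, tpowRep_apply]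
  map_mul' g h := by
    refine Submodule.linearMap_qext _ ?_
    refine PiTensorProduct.ext ?_
    ext f
    simp [Submodule.mapQ_apply, tpowRep_apply]

/-- The subspace of the `m`-th tensor power by which one quotients to obtain
the `m`-th exterior power: the span of pure tensors with two equal entries. -/
def altPowSub (m : ℕ) : Submodule k (⨂[k] (_ : Fin m), V) :=
  Submodule.span k {z | ∃ (f : Fin m → V) (i j : Fin m), i ≠ j ∧ f i = f j ∧
    z = PiTensorProduct.tprod k f}

/-- The `m`-th exterior power of a `k`-vector space. -/
abbrev AltPow (m : ℕ) := (⨂[k] (_ : Fin m), V) ⧸ altPowSub k V m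

/-- The `m`-th exterior power of a representation. -/
def altPowRep (m : ℕ) (ρ : Representation k G V) :
    Representation k G (AltPow k V m) where
  toFun g := Submodule.mapQ _ _ (tpowRep k V m ρ g) (by
    rw [altPowSub, Submodule.span_le]
    rintro z ⟨f, i, j, hij, hfij, rfl⟩
    simp only [SetLike.mem_coe, Submodule.mem_comap, tpowRep_apply]
    exact Submodule.subset_span ⟨fun i => ρ g (f i), i, j, hij, by simp only [hfij], rfl⟩)
  map_one' := by
    refine Submodule.linearMap_qext _ (PiTensorProduct.ext ?_)
    ext f
    simp [Submodule.mapQ_apply, tpowRep_apply]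
  map_mul' g h := by
    refine Submodule.linearMap_qext _ (PiTensorProduct.ext ?_)
    ext f
    simp [Submodule.mapQ_apply, tpowRep_apply]

/-- The second divided power `Γ²V ⊆ V ⊗ V`: tensors invariant under the flip. -/
def gamma2 : Submodule k (V ⊗[k] V) :=
  LinearMap.eqLocus (TensorProduct.comm k V V).toLinearMap LinearMap.id

lemma comm_comp_map (f : V →ₗ[k] V) :
    (TensorProduct.comm k V V).toLinearMap ∘ₗ TensorProduct.map f f
      = TensorProduct.map f f ∘ₗ (TensorProduct.comm k V V).toLinearMap :=
  TensorProduct.ext' fun x y => by simp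

lemma gamma2_stable (f : V →ₗ[k] V) :
    ∀ z ∈ gamma2 k V, TensorProduct.map f f z ∈ gamma2 k V := by
  intro z hz
  have h1 : (TensorProduct.comm k V V).toLinearMap z = z := hz
  have h2 := congrArg (fun φ => φ z) (comm_comp_map k V f)
  simp only [LinearMap.comp_apply] at h2
  rw [h1] at h2
  exact h2

/-- The second divided power of a representation. -/
def gamma2Rep (ρ : Representation k G V) : Representation k G (gamma2 k V) where
  toFun g := ((ρ.tprod ρ) g).restrict (p := gamma2 k V) (q := gamma2 k V)
    (gamma2_stable k V (ρ g))
  map_one' := by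
    ext z
    simp [LinearMap.restrict_apply, Representation.tprod_apply]
  map_mul' g h := by
    ext z
    simp only [LinearMap.restrict_apply, Representation.tprod_apply, map_mul,
      Module.End.mul_apply, LinearMap.coe_mk, AddHom.coe_mk, Submodule.coe_subtype]

namespace GLC
section Abstract
variable {k : Type} [Field k] {G : Type} [Group G] {M : Type} [AddCommGroup M] [Module k M]

/-- inhomogeneous 2-cocycles -/
def Coc (ρ : Representation k G M) (c : G → G → M) : Prop :=
  ∀ g h x, ρ g (c h x) + c g (h * x) = c (g * h) x + c g h

/-- coboundary of a 1-cochain -/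
def dd (ρ : Representation k G M) (b : G → M) (g h : G) : M := ρ g (b h) - b (g * h) + b g

lemma coc_dd (ρ : Representation k G M) (b : G → M) : Coc ρ (dd ρ b) := by
  intro g h x
  simp only [dd, map_add, map_sub, map_mul, Module.End.mul_apply, mul_assoc]
  abel

lemma Coc.sub {ρ : Representation k G M} {c c' : G → G → M} (h : Coc ρ c) (h' : Coc ρ c') :
    Coc ρ (fun g x => c g x - c' g x) := by
  intro g x y
  have h1 := h g x y
  have h2 := h' g x y
  simp only [map_sub]
  rw [sub_add_sub_comm, h1, h2]; abel

lemma dd_add (ρ : Representation k G M) (b b' : G → M) (g h : G) :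
    dd ρ (fun x => b x + b' x) g h = dd ρ b g h + dd ρ b' g h := by
  simp only [dd, map_add]; abel

lemma L1 {ρ : Representation k G M} {c : G → G → M} (hc : Coc ρ c) (H : Subgroup G)
    (b : G → M) (hb : ∀ g ∈ H, ∀ h ∈ H, c g h = dd ρ b g h) :
    ∃ b', ∀ g, ∀ h ∈ H, c g h = dd ρ b' g h := by
  classical
  let r : G → G := fun g => (QuotientGroup.mk g : G ⧸ H).out
  have hr : ∀ g, (r g)⁻¹ * g ∈ H := fun g => by
    rw [← QuotientGroup.eq]; exact Quotient.out_eq _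
  have hr2 : ∀ g, ∀ h ∈ H, r (g * h) = r g := fun g h hh => by
    have : (QuotientGroup.mk (g * h) : G ⧸ H) = QuotientGroup.mk g := by
      rw [QuotientGroup.eq]; simpa using H.inv_mem hh
    simp only [r, this]
  refine ⟨fun g => ρ (r g) (b ((r g)⁻¹ * g)) - c (r g) ((r g)⁻¹ * g) + b (r g),
    fun g h hh => ?_⟩
  have key : ∀ y ∈ H, ρ (r 1) (b ((r 1)⁻¹ * y)) - c (r 1) ((r 1)⁻¹ * y) =
      b y - b (r 1) + (ρ (r 1) (b ((r 1)⁻¹)) - c (r 1) ((r 1)⁻¹) + b (r 1) - b 1) := by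
    intro y hy
    have h1 : (r 1) ∈ H := by simpa using H.inv_mem (hr 1)
    have e1 := hb (r 1) h1 ((r 1)⁻¹ * y) (H.mul_mem (H.inv_mem h1) hy)
    have e2 := hb (r 1) h1 ((r 1)⁻¹) (H.inv_mem h1)
    simp only [dd, mul_inv_cancel_left, mul_inv_cancel] at e1 e2
    rw [e1, e2]; abel
  have h1 : (r 1) ∈ H := by simpa using H.inv_mem (hr 1)
  have e2 := hb (r 1) h1 ((r 1)⁻¹) (H.inv_mem h1)
  simp only [dd, mul_inv_cancel] at e2
  have hh' : r h = r 1 := by simpa using hr2 1 h hh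
  simp only [dd]
  rw [hr2 g h hh, hh', key h hh, e2]
  have e3 := hc (r g) ((r g)⁻¹ * g) h
  have e4 := hb ((r g)⁻¹ * g) (hr g) h hh
  simp only [dd] at e4
  rw [e4] at e3
  simp only [map_add, map_sub, ← Module.End.mul_apply, ← map_mul, mul_inv_cancel_left,
    mul_assoc] at e3 ⊢
  have : c g h = ρ g (b h) - ρ (r g) (b ((r g)⁻¹ * (g * h))) + ρ (r g) (b ((r g)⁻¹ * g)) +
      c (r g) ((r g)⁻¹ * (g * h)) - c (r g) ((r g)⁻¹ * g) := by
    rw [e3]; abel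
  rw [this]; abel

lemma L2 {ρ : Representation k G M} {c : G → G → M} (hc : Coc ρ c) (H : Subgroup G) [Finite G]
    (hi : (H.index : k) ≠ 0)
    (b : G → M) (hb : ∀ g ∈ H, ∀ h ∈ H, c g h = dd ρ b g h) :
    ∃ b', ∀ g h, c g h = dd ρ b' g h := by
  classical
  obtain ⟨b', hb'⟩ := L1 hc H b hb
  have hc2 := hc.sub (coc_dd ρ b')
  set e : G → G → M := fun g x => c g x - dd ρ b' g x with he
  have e0 : ∀ g, ∀ h ∈ H, e g h = 0 := fun g h hh => by simp [he, hb' g h hh]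
  have e1 : ∀ g h, ∀ x ∈ H, e g (h * x) = e g h := fun g h x hx => by
    have := hc2 g h x
    rw [e0 _ _ hx, e0 _ _ hx] at this; simpa using this
  cases nonempty_fintype (G ⧸ H)
  let E : G → G ⧸ H → M := fun g => Quotient.lift (e g) (fun a b hab => by
    have : a⁻¹ * b ∈ H := QuotientGroup.leftRel_apply.mp hab
    have := e1 g a _ this
    simpa using this.symm)
  have hE : ∀ g h : G, ∀ x : G ⧸ H, ρ g (E h x) + E g (h • x) = E (g * h) x + e g h := by
    intro g h x
    induction x using QuotientGroup.induction_on with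
    | H x => exact hc2 g h x
  refine ⟨fun g => b' g + (H.index : k)⁻¹ • ∑ x, E g x, fun g h => ?_⟩
  rw [dd_add]
  have hs : ρ g (∑ x, E h x) + ∑ x, E g x = ∑ x, E (g * h) x + (H.index : k) • e g h := by
    have : ∑ x, E g x = ∑ x, E g (h • x) :=
      (Equiv.sum_comp (MulAction.toPerm h : Equiv.Perm (G ⧸ H)) (E g)).symm
    rw [this, map_sum, ← Finset.sum_add_distrib, Finset.sum_congr rfl (fun x _ => hE g h x),
      Finset.sum_add_distrib, Finset.sum_const, Finset.card_univ, ← Nat.card_eq_fintype_card,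
      ← Subgroup.index_eq_card, Nat.cast_smul_eq_nsmul]
  have : e g h = dd ρ (fun g => (H.index : k)⁻¹ • ∑ x, E g x) g h := by
    simp only [dd, map_smul]
    rw [← smul_sub, ← smul_add, eq_inv_smul_iff₀ hi, sub_add_eq_add_sub, hs]; abel
  rw [← this]; simp [he]

lemma L3 {ρ : Representation k G M} {c : G → G → M} (hc : Coc ρ c) (N P : Subgroup G)
    (hNP : N ≤ P) (hn : ∀ g ∈ P, ∀ n ∈ N, g * n * g⁻¹ ∈ N)
    (h0 : ∀ m, (∀ n ∈ N, ρ n m = m) → m = 0)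
    (h1 : ∀ f : G → M, (∀ n ∈ N, ∀ n' ∈ N, f (n * n') = f n + ρ n (f n')) →
      ∃ m, ∀ n ∈ N, f n = ρ n m - m)
    (b : G → M) (hb : ∀ g ∈ N, ∀ h ∈ N, c g h = dd ρ b g h) :
    ∃ b', ∀ g ∈ P, ∀ h ∈ P, c g h = dd ρ b' g h := by
  classical
  obtain ⟨b', hb'⟩ := L1 hc N b hb
  have hc2 := hc.sub (coc_dd ρ b')
  set e : G → G → M := fun g x => c g x - dd ρ b' g x with he
  have e0 : ∀ g, ∀ h ∈ N, e g h = 0 := fun g h hh => by simp [he, hb' g h hh]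
  have e1 : ∀ g h, ∀ x ∈ N, e g (h * x) = e g h := fun g h x hx => by
    have := hc2 g h x
    rw [e0 _ _ hx, e0 _ _ hx] at this; simpa using this
  have hn' : ∀ g ∈ P, ∀ n ∈ N, g⁻¹ * n * g ∈ N := fun g hg n hnn => by
    simpa using hn g⁻¹ (P.inv_mem hg) n hnn
  have e1' : ∀ g, ∀ h ∈ P, ∀ x ∈ N, e g (x * h) = e g h := fun g h hh x hx => by
    have := e1 g h _ (hn' h hh x hx)
    simpa [mul_assoc] using this
  have e2 : ∀ x ∈ P, ∃ m, ∀ n ∈ N, e n x = ρ n m - m := by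
    intro x hx
    refine h1 (fun n => e n x) fun n hnn n' hn' => ?_
    have := hc2 n n' x
    change ρ n (e n' x) + e n (n' * x) = e (n * n') x + e n n' at this
    rw [e1' _ _ hx _ hn', e0 _ _ hn'] at this
    rw [add_zero] at this
    rw [← this]; abel
  choose! m hm using e2
  have hu : ∀ m m', (∀ n ∈ N, ρ n m - m = ρ n m' - m') → m = m' := fun m m' hmm => by
    rw [← sub_eq_zero]; apply h0
    intro n hnn
    rw [map_sub, sub_eq_sub_iff_sub_eq_sub]; exact hmm n hnn
  have m1 : ∀ x ∈ P, ∀ n ∈ N, m (x * n) = m x := fun x hx n hnn => by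
    apply hu
    intro n' hn'
    rw [← hm _ (P.mul_mem hx (hNP hnn)) _ hn', ← hm x hx n' hn', e1 _ _ _ hnn]
  have m1' : ∀ x ∈ P, ∀ n ∈ N, m (n * x) = m x := fun x hx n hnn => by
    have := m1 x hx _ (hn' x hx n hnn)
    simpa [mul_assoc] using this
  have m0 : ∀ n ∈ N, m n = 0 := fun n hnn => by
    apply h0
    intro n' hn'
    rw [← sub_eq_zero, ← hm n (hNP hnn) n' hn', e0 _ _ hnn]
  have hc3 := hc2.sub (coc_dd ρ m)
  set e' : G → G → M := fun g x => e g x - dd ρ m g x with he'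
  have f0 : ∀ g ∈ P, ∀ h ∈ N, e' g h = 0 := fun g hg h hh => by
    simp only [he', dd, e0 g h hh, m0 h hh, m1 g hg h hh]; simp
  have f0' : ∀ n ∈ N, ∀ x ∈ P, e' n x = 0 := fun n hnn x hx => by
    simp only [he', dd, hm x hx n hnn, m0 n hnn, m1' x hx n hnn]; simp
  have f1 : ∀ n ∈ N, ∀ g ∈ P, ∀ x ∈ P, e' (n * g) x = ρ n (e' g x) := by
    intro n hnn g hg x hx
    have := hc3 n g x
    change ρ n (e' g x) + e' n (g * x) = e' (n * g) x + e' n g at this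
    rw [f0' n hnn _ (P.mul_mem hg hx), f0' n hnn _ hg] at this
    simpa using this.symm
  have f2a : ∀ g ∈ P, ∀ h ∈ P, ∀ x ∈ N, e' g (h * x) = e' g h := fun g hg h hh x hx => by
    have := hc3 g h x
    change ρ g (e' h x) + e' g (h * x) = e' (g * h) x + e' g h at this
    rw [f0 _ (P.mul_mem hg hh) _ hx, f0 _ hh _ hx] at this; simpa using this
  have f2 : ∀ g ∈ P, ∀ n ∈ N, ∀ x ∈ P, e' (g * n) x = e' g x := by
    intro g hg n hnn x hx
    have := hc3 g n x
    change ρ g (e' n x) + e' g (n * x) = e' (g * n) x + e' g n at this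
    have h3 : e' g (n * x) = e' g x := by
      have := f2a g hg x hx _ (hn' x hx n hnn)
      simpa [mul_assoc] using this
    rw [f0' n hnn x hx, f0 g hg n hnn, h3] at this
    simpa using this.symm
  refine ⟨fun g => b' g + m g, fun g hg h hh => ?_⟩
  have : e' g h = 0 := by
    apply h0
    intro n hnn
    rw [← f1 n hnn g hg h hh]
    have := f2 g hg _ (hn' g hg n hnn) h hh
    simpa [mul_assoc] using this
  rw [dd_add]
  simp only [he', he] at this
  rw [sub_sub, sub_eq_zero] at this
  exact this

lemma L4 {ρ : Representation k G M} {c : G → G → M} (hc : Coc ρ c) (S : Subgroup G) [Fintype S]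
    (hS : (Fintype.card S : k) ≠ 0) :
    ∃ b, (∀ g, ∀ h ∈ S, c g h = dd ρ b g h) ∧ (∀ g, ∀ h ∈ S, c h g = dd ρ b h g) := by
  classical
  let b' : G → M := fun g => (Fintype.card S : k)⁻¹ • ∑ x : S, c g x
  have hb' : ∀ g, ∀ h ∈ S, c g h = dd ρ b' g h := by
    intro g h hh
    simp only [b', dd, map_smul]
    rw [← smul_sub, ← smul_add, eq_inv_smul_iff₀ hS, map_sum, sub_add_eq_add_sub,
      eq_sub_iff_add_eq, Nat.cast_smul_eq_nsmul]
    have : ∑ x : S, c g x = ∑ x : S, c g (h * x) :=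
      (Equiv.sum_comp (Equiv.mulLeft (⟨h, hh⟩ : S)) (fun x : S => c g x)).symm
    rw [this, ← Finset.sum_add_distrib, Finset.sum_congr rfl (fun (x : S) _ => hc g h x),
      Finset.sum_add_distrib, Finset.sum_const, Finset.card_univ, add_comm]
  have hc2 := hc.sub (coc_dd ρ b')
  set e : G → G → M := fun g x => c g x - dd ρ b' g x with he
  have e0 : ∀ g, ∀ h ∈ S, e g h = 0 := fun g h hh => by simp [he, hb' g h hh]
  have e1 : ∀ g h, ∀ x ∈ S, e g (h * x) = e g h := fun g h x hx => by
    have := hc2 g h x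
    rw [e0 _ _ hx, e0 _ _ hx] at this; simpa using this
  let b2 : G → M := fun g => (Fintype.card S : k)⁻¹ • ∑ s : S, ρ (s : G)⁻¹ (e s g)
  have b20 : ∀ s ∈ S, b2 s = 0 := fun s hs => by simp [b2, e0 _ s hs]
  have b21 : ∀ g, ∀ s ∈ S, b2 (g * s) = b2 g := fun g s hs => by simp [b2, e1 _ _ s hs]
  refine ⟨fun g => b' g + b2 g, fun g h hh => ?_, fun x t ht => ?_⟩
  · rw [dd_add]
    have : dd ρ b2 g h = 0 := by simp [dd, b20 h hh, b21 g h hh]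
    rw [this, add_zero]; exact hb' g h hh
  · rw [dd_add]
    have : e t x = dd ρ b2 t x := by
      simp only [dd, b20 t ht, add_zero]
      simp only [b2, map_smul]
      rw [← smul_sub, eq_inv_smul_iff₀ hS, map_sum]
      have : ∑ s : S, ρ t (ρ (s : G)⁻¹ (e s x)) = ∑ s : S, ρ t (ρ ((s : G) * t)⁻¹ (e (s * t) x)) :=
        (Equiv.sum_comp (Equiv.mulRight (⟨t, ht⟩ : S))
          (fun s : S => ρ t (ρ (s : G)⁻¹ (e s x)))).symm
      rw [this, ← Finset.sum_sub_distrib, Nat.cast_smul_eq_nsmul, ← Finset.card_univ,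
        ← Finset.sum_const]
      refine Finset.sum_congr rfl fun s _ => ?_
      have := hc2 s t x
      change ρ (s:G) (e t x) + e s (t * x) = e (s * t) x + e s t at this
      rw [e0 _ t ht, add_zero, ← eq_sub_iff_add_eq] at this
      have := congrArg (ρ (s : G)⁻¹) this
      simp only [← Module.End.mul_apply, ← map_mul, map_sub] at this ⊢
      simpa using this
    rw [← this]; simp [he]

/-- degree one analogue: from `N` to `G` -/
lemma L5 {ρ : Representation k G M} {f : G → M} (hf : ∀ g h, f (g * h) = f g + ρ g (f h))
    (N P : Subgroup G) [Finite G]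
    (hn : ∀ g ∈ P, ∀ n ∈ N, g * n * g⁻¹ ∈ N)
    (h0 : ∀ m, (∀ n ∈ N, ρ n m = m) → m = 0) (hi : (P.index : k) ≠ 0)
    (m : M) (hm : ∀ n ∈ N, f n = ρ n m - m) : ∃ m, ∀ g, f g = ρ g m - m := by
  classical
  set e : G → M := fun g => f g - (ρ g m - m) with he
  have he1 : ∀ g h, e (g * h) = e g + ρ g (e h) := fun g h => by
    simp only [he, hf, map_sub, map_mul, Module.End.mul_apply]; abel
  have e0 : ∀ n ∈ N, e n = 0 := fun n hnn => by simp [he, hm n hnn]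
  have e1 : ∀ g ∈ P, e g = 0 := fun g hg => by
    apply h0
    intro n hnn
    have a1 := he1 n g
    have hn' : g⁻¹ * n * g ∈ N := by simpa using hn g⁻¹ (P.inv_mem hg) n hnn
    have a2 := he1 g (g⁻¹ * n * g)
    rw [e0 _ hn'] at a2
    rw [e0 _ hnn] at a1
    simp only [mul_assoc, mul_inv_cancel_left] at a2
    rw [a2] at a1
    simpa using a1.symm
  cases nonempty_fintype (G ⧸ P)
  let E : G ⧸ P → M := Quotient.lift e (fun a b hab => by
    have : a⁻¹ * b ∈ P := QuotientGroup.leftRel_apply.mp hab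
    have h2 := he1 a (a⁻¹ * b)
    rw [e1 _ this] at h2
    simpa using h2.symm)
  have hE : ∀ g : G, ∀ x : G ⧸ P, E (g • x) = e g + ρ g (E x) := by
    intro g x
    induction x using QuotientGroup.induction_on with
    | H x => exact he1 g x
  refine ⟨m - (P.index : k)⁻¹ • ∑ x, E x, fun g => ?_⟩
  have : ∑ x, E x = ∑ x, E (g • x) :=
      (Equiv.sum_comp (MulAction.toPerm g : Equiv.Perm (G ⧸ P)) E).symm
  have h3 : ∑ x, E x = (P.index : k) • e g + ρ g (∑ x, E x) := by
    conv_lhs => rw [this, Finset.sum_congr rfl (fun x _ => hE g x)]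
    rw [Finset.sum_add_distrib, Finset.sum_const, Finset.card_univ, ← Nat.card_eq_fintype_card,
      ← Subgroup.index_eq_card, Nat.cast_smul_eq_nsmul, map_sum]
  have h4 : e g = (P.index : k)⁻¹ • ∑ x, E x - (P.index : k)⁻¹ • ρ g (∑ x, E x) := by
    rw [← smul_sub, eq_inv_smul_iff₀ hi, eq_sub_iff_add_eq, ← h3]
  have h5 : f g = e g + (ρ g m - m) := by simp [he]
  rw [h5, h4]; simp only [map_sub, map_smul]; abel

end Abstract
end GLC

namespace GLC
section Triv
variable {k : Type} [Field k] {A : Type} [AddCommGroup A] [Module k A]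
  {X : Type} [AddCommGroup X] [Module k X]

/-- 2-cocycles for the trivial action -/
def TC (C : A → A → X) : Prop := ∀ a b d, C b d + C a (b + d) = C (a + b) d + C a b

lemma TC.om {C : A → A → X} (h : TC C) (a b d : A) :
    C (a + b) d - C d (a + b) = (C a d - C d a) + (C b d - C d b) := by
  have h1 := h a b d
  have h2 := h d a b
  have h3 := h a d b
  rw [add_comm d b, add_comm a d] at h3
  have e1 : C (a + b) d = C b d + C a (b + d) - C a b := by rw [h1]; abel
  have e2 : C d (a + b) = C (d + a) b + C d a - C a b := by rw [← h2]; abel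
  have e3 : C a (b + d) = C (d + a) b + C a d - C d b := by rw [← h3]; abel
  rw [e1, e2, e3]; abel

lemma TC.four {C : A → A → X} (h : TC C) (hs : ∀ a b, C a b = C b a) (u v a b : A) :
    C (u + v) (a + b) + C u v + C a b = C (u + a) (v + b) + C u a + C v b := by
  have h1 := h u v (a + b)
  have h2 := h v a b
  have h3 := h u a (v + b)
  have h4 := h a v b
  have e : a + (v + b) = v + (a + b) := by abel
  rw [e] at h3
  rw [hs a v, add_comm a v] at h4
  have e1 : C (u + v) (a + b) = C v (a + b) + C u (v + (a + b)) - C u v := by rw [h1]; abel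
  have e2 : C v (a + b) = C (v + a) b + C v a - C a b := by rw [← h2]; abel
  have e3 : C (u + a) (v + b) = C a (v + b) + C u (v + (a + b)) - C u a := by rw [h3]; abel
  have e4 : C a (v + b) = C (v + a) b + C v a - C v b := by rw [← h4]; abel
  rw [e1, e2, e3, e4]; abel

lemma TC.fadd_aux {C : A → A → X} (h : TC C) (hs : ∀ a b, C a b = C b a) (h0 : ∀ a, C 0 a = 0)
    (m : ℕ) (a b : A) :
    ∑ i ∈ Finset.range m, C (i • (a + b)) (a + b) =
    ∑ i ∈ Finset.range m, C (i • a) a + ∑ i ∈ Finset.range m, C (i • b) b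
      + C (m • a) (m • b) - m • C a b := by
  induction m with
  | zero => simp [h0]
  | succ m ih =>
    rw [Finset.sum_range_succ, Finset.sum_range_succ, Finset.sum_range_succ, ih]
    have := h.four hs (m • a) (m • b) a b
    rw [← smul_add] at this
    have e : C (m • (a + b)) (a + b) = C (m • a + a) (m • b + b) + C (m • a) a + C (m • b) b
      - C (m • a) (m • b) - C a b := by rw [← this]; abel
    rw [e, succ_nsmul a, succ_nsmul b, succ_nsmul (C a b)]
    abel

variable {p : ℕ} [CharP k p]

lemma psmul (k : Type) [Field k] {A : Type} [AddCommGroup A] [Module k A] {p : ℕ} [CharP k p]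
    (a : A) : p • a = 0 := by
  rw [← Nat.cast_smul_eq_nsmul k, CharP.cast_eq_zero, zero_smul]

lemma TC.fadd {C : A → A → X} (h : TC C) (hs : ∀ a b, C a b = C b a) (h0 : ∀ a, C 0 a = 0)
    (hA : ∀ a : A, p • a = 0) (hX : ∀ x : X, p • x = 0) (a b : A) :
    ∑ i ∈ Finset.range p, C (i • (a + b)) (a + b) =
    ∑ i ∈ Finset.range p, C (i • a) a + ∑ i ∈ Finset.range p, C (i • b) b := by
  rw [h.fadd_aux hs h0, hA, hA, hX, h0]; simp

lemma exists_section_aux {E A : Type} [AddCommGroup E] [AddCommGroup A] [Fact p.Prime]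
    [Module (ZMod p) E] [Module (ZMod p) A] (π : E →+ A)
    (hπ : Function.Surjective π) : ∃ s : A →+ E, ∀ a, π (s a) = a := by
  obtain ⟨s, hs'⟩ := LinearMap.exists_rightInverse_of_surjective (π.toZModLinearMap p)
    (LinearMap.range_eq_top.mpr hπ)
  exact ⟨s.toAddMonoidHom, fun a => LinearMap.congr_fun hs' a⟩

lemma exists_section {E A : Type} [AddCommGroup E] [AddCommGroup A] (hp : p.Prime)
    (hE : ∀ a : E, p • a = 0) (hA : ∀ a : A, p • a = 0) (π : E →+ A)
    (hπ : Function.Surjective π) : ∃ s : A →+ E, ∀ a, π (s a) = a := by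
  have := Fact.mk hp
  exact @exists_section_aux p E A _ _ _ (AddCommGroup.zmodModule hE) (AddCommGroup.zmodModule hA)
    π hπ

/-- carrier of the extension -/
@[ext] structure ExtT (X A : Type) where
  /-- kernel part -/
  fst : X
  /-- quotient part -/
  snd : A

lemma TC.split {C : A → A → X} (h : TC C) (hs : ∀ a b, C a b = C b a) (h0 : ∀ a, C 0 a = 0)
    (hp : p.Prime) (hA : ∀ a : A, p • a = 0) (hX : ∀ x : X, p • x = 0)
    (hf : ∀ a, ∑ i ∈ Finset.range p, C (i • a) a = 0) :
    ∃ φ : A → X, ∀ a b, C a b = φ b - φ (a + b) + φ a := by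
  have := Fact.mk hp
  let E := ExtT X A
  let plus : E → E → E := fun u v => ⟨u.fst + v.fst + C u.snd v.snd, u.snd + v.snd⟩
  let iA : Add E := ⟨plus⟩
  have hadd : ∀ u v : E, u + v = ⟨u.fst + v.fst + C u.snd v.snd, u.snd + v.snd⟩ := fun _ _ => rfl
  let iZ : Zero E := ⟨⟨0, 0⟩⟩
  let iN : Neg E := ⟨fun u => ⟨-u.fst - C (-u.snd) u.snd, -u.snd⟩⟩
  have hzero : (0 : E) = ⟨0, 0⟩ := rfl
  have hneg : ∀ u : E, -u = ⟨-u.fst - C (-u.snd) u.snd, -u.snd⟩ := fun _ => rfl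
  let G1 : AddGroup E := AddGroup.ofLeftAxioms
    (by
      intro u v w
      rw [hadd, hadd, hadd, hadd]
      refine ExtT.ext ?_ (add_assoc _ _ _)
      have := h u.snd v.snd w.snd
      simp only
      have e : C (u.snd + v.snd) w.snd = C v.snd w.snd + C u.snd (v.snd + w.snd) - C u.snd v.snd := by rw [this]; abel
      rw [e]; abel)
    (by intro u; rw [hadd, hzero]; refine ExtT.ext ?_ ?_ <;> simp [h0])
    (by intro u; rw [hadd, hneg, hzero]; refine ExtT.ext ?_ ?_ <;> simp <;> abel)
  let G2 : AddCommGroup E := { G1 with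
    add_comm := fun u v => by
      change u + v = v + u
      rw [hadd, hadd, hs u.snd v.snd, add_comm u.fst, add_comm u.snd] }
  have hadd' : ∀ u v : E, u + v = ⟨u.fst + v.fst + C u.snd v.snd, u.snd + v.snd⟩ := fun _ _ => rfl
  have hzero' : (0 : E) = ⟨0, 0⟩ := rfl
  have hsm : ∀ (m : ℕ) (u : E), m • u = ⟨m • u.fst + ∑ i ∈ Finset.range m, C (i • u.snd) u.snd, m • u.snd⟩ := by
    intro m u
    induction m with
    | zero => rw [zero_nsmul, hzero']; simp
    | succ m ih =>
      rw [succ_nsmul, ih, hadd']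
      simp only [succ_nsmul, Finset.sum_range_succ]
      refine ExtT.ext ?_ rfl
      simp only; abel
  have hE : ∀ u : E, p • u = 0 := by
    intro u
    rw [hsm, hf, hA, hX, hzero']; simp
  let π : E →+ A := { toFun := fun u => u.snd, map_zero' := rfl, map_add' := fun _ _ => rfl }
  obtain ⟨s, hs2⟩ := exists_section hp hE hA π (fun a => ⟨⟨0, a⟩, rfl⟩)
  replace hs2 : ∀ a, (s a).snd = a := hs2
  refine ⟨fun a => - (s a).fst, fun a b => ?_⟩
  have h1 : s (a + b) = s a + s b := map_add s a b
  have h2 := congrArg ExtT.fst h1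
  rw [hadd'] at h2
  simp only [hs2] at h2
  simp only [h2]; abel

variable [Fintype k] [DecidableEq k]

lemma card_units_ne : (Fintype.card kˣ : k) ≠ 0 := by
  classical
  rw [Fintype.card_units, Nat.cast_sub Fintype.card_pos, FiniteField.cast_card_eq_zero]
  simp

lemma TC.split_eq {C : A → A → X} (h : TC C) (hs : ∀ a b, C a b = C b a) (h0 : ∀ a, C 0 a = 0)
    (hp : p.Prime)
    (hf : ∀ a, ∑ i ∈ Finset.range p, C (i • a) a = 0) (w : ℤ)
    (hw : ∀ (t : kˣ) a b, C ((t : k) • a) ((t : k) • b) = ((t : k) ^ w) • C a b) :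
    ∃ φ : A → X, (∀ (t : kˣ) a, φ ((t : k) • a) = ((t : k) ^ w) • φ a) ∧
      ∀ a b, C a b = φ b - φ (a + b) + φ a := by
  classical
  obtain ⟨φ, hφ⟩ := h.split hs h0 hp (fun a => psmul k a)
    (fun a => psmul k a) hf
  refine ⟨fun a => (Fintype.card kˣ : k)⁻¹ • ∑ t : kˣ, ((t : k) ^ w)⁻¹ • φ ((t : k) • a), ?_, ?_⟩
  · intro t a
    simp only [smul_comm ((t : k) ^ w) (Fintype.card kˣ : k)⁻¹]
    congr 1
    rw [Finset.smul_sum]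
    refine Fintype.sum_equiv (Equiv.mulRight t) _ _ fun s => ?_
    simp only [Equiv.coe_mulRight, Units.val_mul, mul_zpow, mul_inv, smul_smul]
    rw [mul_comm (((s:k) ^ w)⁻¹), ← mul_assoc, mul_inv_cancel₀ (zpow_ne_zero _ t.ne_zero), one_mul]
  · intro a b
    rw [← smul_sub, ← smul_add, eq_inv_smul_iff₀ card_units_ne, ← Finset.sum_sub_distrib,
      ← Finset.sum_add_distrib, Nat.cast_smul_eq_nsmul, ← Finset.card_univ, ← Finset.sum_const]
    refine Finset.sum_congr rfl fun t _ => ?_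
    rw [smul_add, ← smul_sub, ← smul_add, ← hφ, hw, smul_smul,
      inv_mul_cancel₀ (zpow_ne_zero _ t.ne_zero), one_smul]

/-- alternating part vanishes in weights -1, 0, 1 -/
lemma TC.om_zero {C : A → A → X} (h : TC C) (hp5 : 5 ≤ p) (hp : p.Prime) (w : ℤ)
    (hww : w = -1 ∨ w = 0 ∨ w = 1)
    (hw : ∀ (t : kˣ) a b, C ((t : k) • a) ((t : k) • b) = ((t : k) ^ w) • C a b) :
    ∀ a b, C a b = C b a := by
  intro a b
  set W : A → A → X := fun a b => C a b - C b a with hW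
  have W1 : ∀ a b d, W (a + b) d = W a d + W b d := fun a b d => h.om a b d
  have W2 : ∀ a b d, W d (a + b) = W d a + W d b := fun a b d => by
    have := h.om a b d
    simp only [hW]
    rw [← neg_inj, neg_sub, this]; abel
  have hnat : ∀ m : ℕ, 0 < m → m < p → (m : k) ≠ 0 := fun m h1 h2 h3 => by
    rw [CharP.cast_eq_zero_iff k p] at h3
    exact absurd (Nat.le_of_dvd h1 h3) (by omega)
  have h2 : (2 : k) ≠ 0 := by simpa using hnat 2 (by omega) (by omega)
  have h3 : (3 : k) ≠ 0 := by simpa using hnat 3 (by omega) (by omega)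
  have e2 : (4 : k) • W a b = (2 : k) ^ w • W a b := by
    have := hw (Units.mk0 2 h2) a b
    have t := hw (Units.mk0 2 h2) b a
    simp only [Units.val_mk0] at this t
    have : W ((2 : k) • a) ((2 : k) • b) = (2 : k) ^ w • W a b := by
      simp only [hW, this, t, smul_sub]
    rw [← this, two_smul, two_smul, W1, W2]
    module
  have e3 : (9 : k) • W a b = (3 : k) ^ w • W a b := by
    have := hw (Units.mk0 3 h3) a b
    have t := hw (Units.mk0 3 h3) b a
    simp only [Units.val_mk0] at this t
    have : W ((3 : k) • a) ((3 : k) • b) = (3 : k) ^ w • W a b := by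
      simp only [hW, this, t, smul_sub]
    have e : ∀ x : A, (3 : k) • x = x + x + x := fun x => by module
    rw [← this, e, e, W1, W1, W2, W2]
    module
  suffices W a b = 0 by simpa [hW, sub_eq_zero] using this
  rcases hww with rfl | rfl | rfl
  · rw [zpow_neg_one, eq_inv_smul_iff₀ h2] at e2
    rw [zpow_neg_one, eq_inv_smul_iff₀ h3] at e3
    have e2' : (7 : k) • W a b = 0 := by
      have : (7 : k) • W a b = (2 : k) • (4 : k) • W a b - W a b := by module
      rw [this, e2, sub_self]
    have e3' : (26 : k) • W a b = 0 := by
      have : (26 : k) • W a b = (3 : k) • (9 : k) • W a b - W a b := by module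
      rw [this, e3, sub_self]
    have : (2 : k) • W a b = (4 : k) • (7 : k) • W a b - (26 : k) • W a b := by module
    rw [e2', e3'] at this
    simpa [h2] using this
  · have : (3 : k) • W a b = (4 : k) • W a b - (2 : k) ^ (0 : ℤ) • W a b := by
      rw [zpow_zero]; module
    rw [e2, sub_self] at this
    simpa [h3] using this
  · have : (2 : k) • W a b = (4 : k) • W a b - (2 : k) ^ (1 : ℤ) • W a b := by
      rw [zpow_one]; module
    rw [e2, sub_self] at this
    simpa [h2] using this

/-- additive maps of weight -1, 0, 2 vanish -/
lemma add_zero_of_weight {f : A → X} (hp5 : 5 ≤ p) (hfa : ∀ a b, f (a + b) = f a + f b) (w : ℤ)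
    (hww : w = -1 ∨ w = 0 ∨ w = 2)
    (hw : ∀ (t : kˣ) a, f ((t : k) • a) = ((t : k) ^ w) • f a) (a : A) : f a = 0 := by
  have hnat : ∀ m : ℕ, 0 < m → m < p → (m : k) ≠ 0 := fun m h1 h2 h3 => by
    rw [CharP.cast_eq_zero_iff k p] at h3
    exact absurd (Nat.le_of_dvd h1 h3) (by omega)
  have h2 : (2 : k) ≠ 0 := by simpa using hnat 2 (by omega) (by omega)
  have h3 : (3 : k) ≠ 0 := by simpa using hnat 3 (by omega) (by omega)
  have e2 : (2 : k) • f a = (2 : k) ^ w • f a := by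
    have := hw (Units.mk0 2 h2) a
    simp only [Units.val_mk0] at this
    rw [← this, two_smul, two_smul, hfa]
  rcases hww with rfl | rfl | rfl
  · rw [zpow_neg_one, eq_inv_smul_iff₀ h2] at e2
    have : (3 : k) • f a = (2 : k) • (2 : k) • f a - f a := by module
    rw [e2, sub_self] at this
    simpa [h3] using this
  · rw [zpow_zero] at e2
    have : f a = (2 : k) • f a - (1 : k) • f a := by module
    rw [e2, sub_self] at this
    exact this
  · have : (2 : k) • f a = (2 : k) ^ (2 : ℤ) • f a - (2 : k) • f a := by
      rw [show (2 : k) ^ (2 : ℤ) = 4 by norm_num]; module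
    rw [e2, sub_self] at this
    rw [← e2] at this
    simpa [h2] using this

/-- biadditive maps of weight two are linear in the first variable -/
lemma bilin_of_weight {W : A → A → X} (W1 : ∀ a b d, W (a + b) d = W a d + W b d)
    (W2 : ∀ a b d, W d (a + b) = W d a + W d b)
    (hw : ∀ (t : kˣ) a b, W ((t : k) • a) ((t : k) • b) = ((t : k) ^ (2 : ℤ)) • W a b)
    (t : k) (a b : A) : W (t • a) b = t • W a b := by
  have z1 : ∀ b, W 0 b = 0 := fun b => by simpa using W1 0 0 b
  have hw' : ∀ (t : k) a b, W (t • a) (t • b) = t ^ 2 • W a b := fun t a b => by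
    by_cases ht : t = 0
    · simp [ht, z1]
    · exact_mod_cast hw (Units.mk0 t ht) a b
  have pol : ∀ (t : k) a b, W (t • a) b + W a (t • b) = (2 * t) • W a b := fun t a b => by
    have h1 := hw' (1 + t) a b
    have h2 := hw' t a b
    rw [add_smul, add_smul, W1, W2, W2, h2, one_smul, one_smul] at h1
    have : W (t • a) b + W a (t • b) = (W a b + W a (t • b) + (W (t • a) b + t ^ 2 • W a b)) - W a b
      - t ^ 2 • W a b := by abel
    rw [this, h1]; module
  have rec2 : ∀ m : ℕ, W (t ^ (m + 2) • a) b = (2 * t) • W (t ^ (m + 1) • a) b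
      - t ^ 2 • W (t ^ m • a) b := fun m => by
    have h1 := pol t (t ^ (m + 1) • a) b
    have h2 := hw' t (t ^ m • a) b
    rw [smul_smul, ← pow_succ'] at h1 h2
    rw [h2] at h1
    rw [← h1]; simp
  have key : ∀ m : ℕ, W (t ^ (m + 1) • a) b = ((m + 1 : k) * t ^ m) • W (t • a) b -
      ((m : k) * t ^ (m + 1)) • W a b := by
    intro m
    induction m using Nat.strong_induction_on with
    | _ m ih =>
      match m with
      | 0 => simp
      | 1 =>
        have := rec2 0
        simp only [zero_add, pow_zero, one_smul, pow_one] at this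
        rw [show 1 + 1 = 0 + 2 from rfl] 
        simp only [zero_add, pow_zero, one_smul, pow_one, this]
        push_cast
        module
      | m + 2 =>
        rw [show m + 2 + 1 = (m + 1) + 2 from rfl, rec2, ih (m + 1) (by omega), ih m (by omega)]
        push_cast
        module
  have hq := key (Fintype.card k - 1)
  have hc : Fintype.card k - 1 + 1 = Fintype.card k := Nat.sub_add_cancel Fintype.card_pos
  rw [hc, Nat.cast_sub Fintype.card_pos, FiniteField.cast_card_eq_zero, FiniteField.pow_card] at hq
  rw [hq]; simp

end Triv
end GLC

namespace GLC
open scoped Kronecker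
section Coord
variable {k : Type} [Field k] {ι : Type} [Fintype ι] [DecidableEq ι]

/-- `V ⊗ V ⊗ V* ⊗ V*` as matrices -/
abbrev M4 (k ι : Type) := Matrix (ι × ι) (ι × ι) k

/-- tensor square of a matrix -/
def K2 (g : Matrix ι ι k) : M4 k ι := g ⊗ₖ g

lemma K2_mul (g h : Matrix ι ι k) : K2 (g * h) = K2 g * K2 h :=
  Matrix.mul_kronecker_mul g h g h

lemma K2_one : K2 (1 : Matrix ι ι k) = 1 := Matrix.one_kronecker_one

lemma K2_swap (g : Matrix ι ι k) : (K2 g).submatrix Prod.swap Prod.swap = K2 g := by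
  ext ⟨i, j⟩ ⟨l, r⟩
  simp [K2, mul_comm]

/-- `Hom(Λ²V, S²V)` -/
def MS (k ι : Type) [Field k] [Fintype ι] [DecidableEq ι] : Submodule k (M4 k ι) where
  carrier := {X | X.submatrix Prod.swap id = X ∧ X.submatrix id Prod.swap = -X}
  add_mem' := by
    rintro X Y ⟨h1, h2⟩ ⟨h3, h4⟩
    exact ⟨by rw [Matrix.submatrix_add]; simp [h1, h3], by
      rw [Matrix.submatrix_add]; simp [h2, h4, add_comm]⟩
  zero_mem' := by simp
  smul_mem' := by
    rintro c X ⟨h1, h2⟩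
    exact ⟨by rw [Matrix.submatrix_smul]; simp [h1], by rw [Matrix.submatrix_smul]; simp [h2]⟩

lemma MS.sym {X : M4 k ι} (h : X ∈ MS k ι) (i j : ι) (q : ι × ι) : X (j, i) q = X (i, j) q :=
  congrFun (congrFun h.1 (i, j)) q

lemma MS.alt {X : M4 k ι} (h : X ∈ MS k ι) (i j : ι) (q : ι × ι) : X q (j, i) = - X q (i, j) :=
  congrFun (congrFun h.2 q) (i, j)

lemma MS.mk {X : M4 k ι} (h1 : ∀ i j l r, X (j, i) (l, r) = X (i, j) (l, r))
    (h2 : ∀ i j l r, X (i, j) (r, l) = - X (i, j) (l, r)) : X ∈ MS k ι :=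
  ⟨by ext ⟨i, j⟩ ⟨l, r⟩; exact h1 i j l r, by ext ⟨i, j⟩ ⟨l, r⟩; exact h2 i j l r⟩

lemma MS.conj {X : M4 k ι} (h : X ∈ MS k ι) (g g' : Matrix ι ι k) : K2 g * X * K2 g' ∈ MS k ι := by
  have e1 : ∀ Y : M4 k ι, Y.submatrix Prod.swap id = (1 : M4 k ι).submatrix Prod.swap id * Y := by
    intro Y
    have := Matrix.submatrix_mul_equiv (1 : M4 k ι) Y Prod.swap (Equiv.refl _) id
    simpa using this.symm
  constructor
  · have h1 := Matrix.submatrix_mul_equiv (K2 g) (X * K2 g') Prod.swap (Equiv.prodComm ι ι) id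
    have h2 := Matrix.submatrix_mul_equiv X (K2 g') Prod.swap (Equiv.refl _) id
    have h3 := K2_swap g
    have h4 := h.1
    simp only [Equiv.coe_prodComm, Equiv.coe_refl] at h1 h2
    rw [h3, ← h2, h4] at h1
    rw [Matrix.mul_assoc, ← h1]; simp
  · have h1 := Matrix.submatrix_mul_equiv (K2 g * X) (K2 g') id (Equiv.prodComm ι ι) Prod.swap
    have h2 := Matrix.submatrix_mul_equiv (K2 g) X id (Equiv.refl _) Prod.swap
    have h3 := K2_swap g'
    have h4 := h.2
    simp only [Equiv.coe_prodComm, Equiv.coe_refl] at h1 h2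
    rw [h3, ← h2, h4] at h1
    rw [← h1]; simp

/-- the representation on `V ⊗ V ⊗ V* ⊗ V*` -/
def rep4 : Representation k (GL ι k) (M4 k ι) where
  toFun g :=
    { toFun := fun X => K2 (g : Matrix ι ι k) * X * K2 (↑g⁻¹ : Matrix ι ι k)
      map_add' := fun x y => by rw [mul_add, add_mul]
      map_smul' := fun c x => by simp }
  map_one' := by ext1 X; simp [K2_one]
  map_mul' g h := by
    ext1 X
    simp [K2_mul, Matrix.mul_assoc]

/-- the representation on `Hom(Λ²V, S²V)` -/
def repM (k ι : Type) [Field k] [Fintype ι] [DecidableEq ι] : Representation k (GL ι k) (MS k ι) where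
  toFun g := (rep4 g).restrict (p := MS k ι) (q := MS k ι) (fun _ h => MS.conj h _ _)
  map_one' := by ext1 X; apply Subtype.ext; simp
  map_mul' g h := by ext1 X; apply Subtype.ext; simp; rfl

lemma repM_coe (g : GL ι k) (X : MS k ι) :
    (repM k ι g X : M4 k ι) = K2 (g : Matrix ι ι k) * X * K2 (↑g⁻¹ : Matrix ι ι k) := rfl

/-- the abelian unipotent radical (dual of `V/L`) -/
def AS (k : Type) [Field k] {ι : Type} (o : ι) : Submodule k (ι → k) :=
  LinearMap.ker (LinearMap.proj o : (ι → k) →ₗ[k] k)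

lemma AS.zero {o : ι} (a : AS k o) : (a : ι → k) o = 0 := a.2

/-- unipotent matrix -/
def um (o : ι) (a : ι → k) : Matrix ι ι k := 1 + Matrix.of fun i j => if i = o then a j else 0

lemma um_mul (o : ι) (a b : ι → k) (ha : a o = 0) : um o a * um o b = um o (a + b) := by
  ext i j
  simp only [um, Matrix.mul_apply, Matrix.add_apply, Matrix.of_apply, Pi.add_apply, Matrix.one_apply,
    add_mul, mul_add, Finset.sum_add_distrib]
  by_cases hi : i = o <;> simp [hi, ha]
  ring

lemma um_zero (o : ι) : um o (0 : ι → k) = 1 := by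
  ext i j; simp [um]

/-- unipotent element of GL -/
def uu {o : ι} (a : AS k o) : GL ι k where
  val := um o a
  inv := um o (-(a : ι → k))
  val_inv := by rw [um_mul o (a : ι → k) _ (AS.zero a)]; simp [um_zero]
  inv_val := by rw [um_mul o (-(a : ι → k)) _ (by simp [AS.zero])]; simp [um_zero]

lemma uu_mul {o : ι} (a b : AS k o) : uu a * uu b = uu (a + b) :=
  Units.ext (um_mul o _ _ a.2)

lemma uu_zero {o : ι} : uu (0 : AS k o) = 1 := Units.ext (um_zero o)

lemma uu_pow {o : ι} (a : AS k o) (m : ℕ) : uu a ^ m = uu (m • a) := by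
  induction m with
  | zero => simp [uu_zero]
  | succ m ih => rw [pow_succ, ih, uu_mul, succ_nsmul]

/-- diagonal element -/
def dg (d : ι → kˣ) : GL ι k where
  val := Matrix.diagonal fun i => (d i : k)
  inv := Matrix.diagonal fun i => ((d i)⁻¹ : k)
  val_inv := by rw [Matrix.diagonal_mul_diagonal]; simp
  inv_val := by rw [Matrix.diagonal_mul_diagonal]; simp

lemma dg_act (d : ι → kˣ) (X : MS k ι) (i j l r : ι) :
    (repM k ι (dg d) X : M4 k ι) (i, j) (l, r) =
      d i * d j * (X : M4 k ι) (i, j) (l, r) * ((d l : k)⁻¹ * (d r : k)⁻¹) := by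
  have h1 : K2 (↑(dg d) : Matrix ι ι k) = Matrix.diagonal fun q : ι × ι => (d q.1 : k) * d q.2 :=
    Matrix.diagonal_kronecker_diagonal _ _
  have h2 : K2 (↑(dg d)⁻¹ : Matrix ι ι k) =
      Matrix.diagonal fun q : ι × ι => (d q.1 : k)⁻¹ * (d q.2 : k)⁻¹ :=
    Matrix.diagonal_kronecker_diagonal _ _
  rw [repM_coe, h1, h2, Matrix.mul_diagonal, Matrix.diagonal_mul]

/-- permutation element -/
def pm (π : Equiv.Perm ι) : GL ι k where
  val := (1 : Matrix ι ι k).submatrix π.symm id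
  inv := (1 : Matrix ι ι k).submatrix π id
  val_inv := by
    have e : ∀ x l : ι, π x = l ↔ x = π.symm l := fun x l => by rw [Equiv.eq_symm_apply]
    ext i j; simp [Matrix.mul_apply, Matrix.one_apply, e]
  inv_val := by
    have e : ∀ x l : ι, π.symm x = l ↔ x = π l := fun x l => by rw [Equiv.symm_apply_eq]
    ext i j; simp [Matrix.mul_apply, Matrix.one_apply, e]

lemma pm_act (π : Equiv.Perm ι) (X : MS k ι) (i j l r : ι) :
    (repM k ι (pm π) X : M4 k ι) (i, j) (l, r) =
      (X : M4 k ι) (π.symm i, π.symm j) (π.symm l, π.symm r) := by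
  have e : ∀ x l : ι, π x = l ↔ x = π.symm l := fun x l => by rw [Equiv.eq_symm_apply]
  rw [repM_coe]
  simp [K2, pm, Matrix.mul_apply, Matrix.one_apply, Fintype.sum_prod_type, e]

/-- linear row term -/
def R1 (o : ι) (a : ι → k) (X : M4 k ι) (i j l r : ι) : k :=
  (if i = o then ∑ x, a x * X (x, j) (l, r) else 0) +
  (if j = o then ∑ x, a x * X (i, x) (l, r) else 0)

/-- quadratic row term -/
def R2 (o : ι) (a : ι → k) (X : M4 k ι) (i j l r : ι) : k :=
  if i = o then if j = o then ∑ x, ∑ y, a x * a y * X (x, y) (l, r) else 0 else 0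

/-- linear term of the action of `uu a` -/
def D1 (o : ι) (a : ι → k) (X : M4 k ι) (i j l r : ι) : k :=
  R1 o a X i j l r - a l * X (i, j) (o, r) - a r * X (i, j) (l, o)

/-- quadratic term -/
def D2 (o : ι) (a : ι → k) (X : M4 k ι) (i j l r : ι) : k :=
  R2 o a X i j l r - a l * R1 o a X i j o r - a r * R1 o a X i j l o

/-- cubic term -/
def D3 (o : ι) (a : ι → k) (X : M4 k ι) (i j l r : ι) : k :=
  - a l * R2 o a X i j o r - a r * R2 o a X i j l o

lemma row_act (o : ι) (a : ι → k) (X : M4 k ι) (i j l r : ι) :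
    (K2 (um o a) * X) (i, j) (l, r) = X (i, j) (l, r) + R1 o a X i j l r + R2 o a X i j l r := by
  simp only [K2, um, Matrix.mul_apply, Matrix.kroneckerMap_apply, Matrix.add_apply, Matrix.of_apply,
    Matrix.one_apply, Fintype.sum_prod_type, R1, R2, add_mul, mul_add, Finset.sum_add_distrib]
  by_cases hi : i = o <;> by_cases hj : j = o <;> simp [hi, hj, ← Finset.mul_sum, Finset.sum_add_distrib, mul_assoc]
  all_goals ring

lemma col_act (o : ι) (a : ι → k) (Y : M4 k ι) (hY : Y ∈ MS k ι) (i j l r : ι) :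
    (Y * K2 (um o (-a))) (i, j) (l, r) =
      Y (i, j) (l, r) - a l * Y (i, j) (o, r) - a r * Y (i, j) (l, o) + a l * a r * Y (i,j) (o, o) := by
  simp only [K2, um, Matrix.mul_apply, Matrix.kroneckerMap_apply, Matrix.add_apply, Matrix.of_apply,
    Matrix.one_apply, Fintype.sum_prod_type, add_mul, mul_add, Finset.sum_add_distrib]
  simp
  ring

lemma MS.oo {X : M4 k ι} (h2 : (2 : k) ≠ 0) (h : X ∈ MS k ι) (q : ι × ι) (o : ι) :
    X q (o, o) = 0 := by
  have := MS.alt h o o q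
  have : (2 : k) * X q (o, o) = 0 := by linear_combination this
  simpa [h2] using this

lemma uu_act {o : ι} (h2 : (2 : k) ≠ 0) (a : AS k o) (X : MS k ι) (i j l r : ι) :
    (repM k ι (uu a) X : M4 k ι) (i, j) (l, r) =
      (X : M4 k ι) (i, j) (l, r) + D1 o a X i j l r + D2 o a X i j l r + D3 o a X i j l r := by
  have h1 : (repM k ι (uu a) X : M4 k ι) = K2 (um o (a : ι → k)) * (X : M4 k ι) * K2 (um o (-(a : ι → k))) := rfl
  have h3 : K2 (um o (a : ι → k)) * (X : M4 k ι) ∈ MS k ι := by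
    have := MS.conj X.2 (um o (a : ι → k)) 1
    rwa [K2_one, mul_one] at this
  rw [h1, col_act o a _ h3, MS.oo h2 h3]
  simp only [row_act, D1, D2, D3]
  ring

lemma R1_smul (o : ι) (t : k) (a : ι → k) (X : M4 k ι) (i j l r : ι) :
    R1 o (t • a) X i j l r = t * R1 o a X i j l r := by
  simp only [R1, Pi.smul_apply, smul_eq_mul, mul_add, mul_ite, mul_zero, Finset.mul_sum, mul_assoc]

lemma R2_smul (o : ι) (t : k) (a : ι → k) (X : M4 k ι) (i j l r : ι) :
    R2 o (t • a) X i j l r = t ^ 2 * R2 o a X i j l r := by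
  simp only [R2, Pi.smul_apply, smul_eq_mul, mul_ite, mul_zero, Finset.mul_sum]
  split_ifs
  · exact Finset.sum_congr rfl fun x _ => Finset.sum_congr rfl fun y _ => by ring
  all_goals rfl

lemma D1_smul (o : ι) (t : k) (a : ι → k) (X : M4 k ι) (i j l r : ι) :
    D1 o (t • a) X i j l r = t * D1 o a X i j l r := by
  simp only [D1, R1_smul, Pi.smul_apply, smul_eq_mul]; ring

lemma D2_smul (o : ι) (t : k) (a : ι → k) (X : M4 k ι) (i j l r : ι) :
    D2 o (t • a) X i j l r = t ^ 2 * D2 o a X i j l r := by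
  simp only [D2, R1_smul, R2_smul, Pi.smul_apply, smul_eq_mul]; ring

lemma D3_smul (o : ι) (t : k) (a : ι → k) (X : M4 k ι) (i j l r : ι) :
    D3 o (t • a) X i j l r = t ^ 3 * D3 o a X i j l r := by
  simp only [D3, R2_smul, Pi.smul_apply, smul_eq_mul]; ring

lemma two_ne {p : ℕ} [CharP k p] (hp5 : 5 ≤ p) : (2 : k) ≠ 0 := by
  intro h
  have : ((2 : ℕ) : k) = 0 := by exact_mod_cast h
  rw [CharP.cast_eq_zero_iff k p] at this
  exact absurd (Nat.le_of_dvd (by norm_num) this) (by omega)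

lemma sum_pow_range {p : ℕ} [CharP k p] (hp : p.Prime) (m : ℕ) (hm : m < p - 1) :
    ∑ i ∈ Finset.range p, (i : k) ^ m = 0 := by
  have := Fact.mk hp
  have h1 : ∑ x : ZMod p, x ^ m = 0 := by
    apply FiniteField.sum_pow_lt_card_sub_one
    rwa [ZMod.card]
  have h2 : ∑ i ∈ Finset.range p, ((i : ZMod p)) ^ m = 0 := by
    rw [← h1]
    refine Finset.sum_bij (fun i _ => (i : ZMod p)) (fun _ _ => Finset.mem_univ _) ?_ ?_ ?_
    · intro a ha b hb hab
      rw [ZMod.natCast_eq_natCast_iff] at hab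
      exact Nat.ModEq.eq_of_lt_of_lt hab (Finset.mem_range.mp ha) (Finset.mem_range.mp hb)
    · intro b _
      exact ⟨b.val, Finset.mem_range.mpr (ZMod.val_lt b), ZMod.natCast_zmod_val b⟩
    · intros; rfl
  have h3 := congrArg (ZMod.castHom (dvd_refl p) k) h2
  simpa using h3

/-- the norm element of the cyclic group generated by `uu a` acts by zero -/
lemma norm_zero {p : ℕ} [CharP k p] (hp5 : 5 ≤ p) (hp : p.Prime) {o : ι} (a : AS k o) (X : MS k ι) :
    ∑ i ∈ Finset.range p, repM k ι (uu (i • a)) X = 0 := by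
  apply Subtype.ext
  ext ⟨i, j⟩ ⟨l, r⟩
  rw [AddSubmonoidClass.coe_finset_sum, Matrix.sum_apply]
  have e : ∀ m : ℕ, (repM k ι (uu (m • a)) X : M4 k ι) (i, j) (l, r) =
      (m : k) ^ 0 * (X : M4 k ι) (i, j) (l, r) + (m : k) ^ 1 * D1 o a X i j l r
      + (m : k) ^ 2 * D2 o a X i j l r + (m : k) ^ 3 * D3 o a X i j l r := by
    intro m
    rw [← Nat.cast_smul_eq_nsmul k, uu_act (two_ne hp5)]
    simp only [Submodule.coe_smul, D1_smul, D2_smul, D3_smul]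
    ring
  simp only [e, Finset.sum_add_distrib, ← Finset.sum_mul]
  rw [sum_pow_range hp _ (by omega), sum_pow_range hp _ (by omega), sum_pow_range hp _ (by omega),
    sum_pow_range hp _ (by omega)]
  simp

end Coord
end GLC

namespace GLC
section Weights
variable {k : Type} [Field k] {ι : Type} [Fintype ι] [DecidableEq ι]

/-- indicator -/
def dl (o i : ι) : ℤ := if i = o then 1 else 0

lemma dl_self (o : ι) : dl o o = 1 := by simp [dl]
lemma dl_ne {o i : ι} (h : i ≠ o) : dl o i = 0 := by simp [dl, h]
lemma dl_cases (o i : ι) : (i = o ∧ dl o i = 1) ∨ (i ≠ o ∧ dl o i = 0) := by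
  by_cases h : i = o <;> simp [dl, h]

/-- weight of a coordinate -/
def wt (o i j l r : ι) : ℤ := dl o i + dl o j - dl o l - dl o r

/-- one-parameter subgroup -/
def ss (o : ι) (t : kˣ) : GL ι k := dg fun i => if i = o then t else 1

lemma ss_act (o : ι) (t : kˣ) (X : MS k ι) (i j l r : ι) :
    (repM k ι (ss o t) X : M4 k ι) (i, j) (l, r) = (t : k) ^ wt o i j l r * (X : M4 k ι) (i, j) (l, r) := by
  rw [ss, dg_act]
  have e : ∀ i : ι, (((if i = o then t else 1 : kˣ)) : k) = (t : k) ^ dl o i := by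
    intro i; by_cases h : i = o <;> simp [dl, h]
  have ht : (t : k) ≠ 0 := t.ne_zero
  rw [e, e, e, e, wt, zpow_sub₀ ht, zpow_sub₀ ht, zpow_add₀ ht]
  field_simp

/-- vanishing in low weights -/
def lo (o : ι) (X : M4 k ι) (v : ℤ) : Prop := ∀ i j l r, wt o i j l r ≤ v → X (i, j) (l, r) = 0

lemma R1_zero {o : ι} {a : ι → k} (ha : a o = 0) {X : M4 k ι} {i j l r : ι}
    (h : ∀ i' j' l' r', wt o i' j' l' r' = wt o i j l r - 1 → X (i', j') (l', r') = 0) :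
    R1 o a X i j l r = 0 := by
  unfold R1
  have e1 : (if i = o then ∑ x, a x * X (x, j) (l, r) else 0) = 0 := by
    split_ifs with hi
    · refine Finset.sum_eq_zero fun x _ => ?_
      by_cases hx : x = o
      · rw [hx, ha, zero_mul]
      · rw [h, mul_zero]; subst hi; simp only [wt, dl_ne hx, dl_self]; ring
    · rfl
  have e2 : (if j = o then ∑ x, a x * X (i, x) (l, r) else 0) = 0 := by
    split_ifs with hi
    · refine Finset.sum_eq_zero fun x _ => ?_
      by_cases hx : x = o
      · rw [hx, ha, zero_mul]
      · rw [h, mul_zero]; subst hi; simp only [wt, dl_ne hx, dl_self]; ring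
    · rfl
  rw [e1, e2, add_zero]

lemma R2_zero {o : ι} {a : ι → k} (ha : a o = 0) {X : M4 k ι} {i j l r : ι}
    (h : ∀ i' j' l' r', wt o i' j' l' r' = wt o i j l r - 2 → X (i', j') (l', r') = 0) :
    R2 o a X i j l r = 0 := by
  unfold R2
  split_ifs with hi hj
  · refine Finset.sum_eq_zero fun x _ => Finset.sum_eq_zero fun y _ => ?_
    by_cases hx : x = o
    · rw [hx, ha, zero_mul, zero_mul]
    by_cases hy : y = o
    · rw [hy, ha, mul_zero, zero_mul]
    rw [h, mul_zero]; subst hi; subst hj; simp only [wt, dl_ne hx, dl_ne hy, dl_self]; ring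
  all_goals rfl

lemma mz {o : ι} {a : ι → k} (ha : a o = 0) (l : ι) {y : k} (h : l ≠ o → y = 0) : a l * y = 0 := by
  by_cases hl : l = o
  · rw [hl, ha, zero_mul]
  · rw [h hl, mul_zero]

lemma D1_zero {o : ι} {a : ι → k} (ha : a o = 0) {X : M4 k ι} {i j l r : ι}
    (h : ∀ i' j' l' r', wt o i' j' l' r' = wt o i j l r - 1 → X (i', j') (l', r') = 0) :
    D1 o a X i j l r = 0 := by
  have e1 : a l * X (i, j) (o, r) = 0 := mz ha l fun hl => h _ _ _ _ (by
    simp only [wt, dl_ne hl, dl_self]; ring)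
  have e2 : a r * X (i, j) (l, o) = 0 := mz ha r fun hl => h _ _ _ _ (by
    simp only [wt, dl_ne hl, dl_self]; ring)
  rw [D1, R1_zero ha h, e1, e2]; simp

lemma D2_zero {o : ι} {a : ι → k} (ha : a o = 0) {X : M4 k ι} {i j l r : ι}
    (h : ∀ i' j' l' r', wt o i' j' l' r' = wt o i j l r - 2 → X (i', j') (l', r') = 0) :
    D2 o a X i j l r = 0 := by
  have e1 : a l * R1 o a X i j o r = 0 := mz ha l fun hl => R1_zero ha fun i' j' l' r' h' => h _ _ _ _ (by
    rw [h']; simp only [wt, dl_ne hl, dl_self]; ring)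
  have e2 : a r * R1 o a X i j l o = 0 := mz ha r fun hl => R1_zero ha fun i' j' l' r' h' => h _ _ _ _ (by
    rw [h']; simp only [wt, dl_ne hl, dl_self]; ring)
  rw [D2, R2_zero ha h, e1, e2]; simp

lemma D3_zero {o : ι} {a : ι → k} (ha : a o = 0) {X : M4 k ι} {i j l r : ι}
    (h : ∀ i' j' l' r', wt o i' j' l' r' = wt o i j l r - 3 → X (i', j') (l', r') = 0) :
    D3 o a X i j l r = 0 := by
  have e1 : a l * R2 o a X i j o r = 0 := mz ha l fun hl => R2_zero ha fun i' j' l' r' h' => h _ _ _ _ (by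
    rw [h']; simp only [wt, dl_ne hl, dl_self]; ring)
  have e2 : a r * R2 o a X i j l o = 0 := mz ha r fun hl => R2_zero ha fun i' j' l' r' h' => h _ _ _ _ (by
    rw [h']; simp only [wt, dl_ne hl, dl_self]; ring)
  rw [D3, neg_mul, e1, e2]; simp

lemma uu_lo (h2 : (2 : k) ≠ 0) {o : ι} (a : AS k o) {X : MS k ι} {v : ℤ} (hX : lo o (X : M4 k ι) v)
    {i j l r : ι} (hw : wt o i j l r ≤ v + 1) :
    (repM k ι (uu a) X : M4 k ι) (i, j) (l, r) = (X : M4 k ι) (i, j) (l, r) := by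
  rw [uu_act h2, D1_zero (AS.zero a), D2_zero (AS.zero a), D3_zero (AS.zero a)]
  · simp
  all_goals intro i' j' l' r' h; exact hX _ _ _ _ (by omega)

lemma uu_lo1 (h2 : (2 : k) ≠ 0) {o : ι} (a : AS k o) {X : MS k ι} {v : ℤ} (hX : lo o (X : M4 k ι) v)
    {i j l r : ι} (hw : wt o i j l r ≤ v + 2) :
    (repM k ι (uu a) X : M4 k ι) (i, j) (l, r) =
      (X : M4 k ι) (i, j) (l, r) + D1 o a (X : M4 k ι) i j l r := by
  rw [uu_act h2, D2_zero (AS.zero a), D3_zero (AS.zero a)]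
  · simp
  all_goals intro i' j' l' r' h; exact hX _ _ _ _ (by omega)

lemma lo_init (h2 : (2 : k) ≠ 0) (o : ι) (X : MS k ι) : lo o (X : M4 k ι) (-2) := by
  intro i j l r h
  have hl : l = o ∧ r = o := by
    simp only [wt] at h
    rcases dl_cases o i with ⟨_, h1⟩ | ⟨_, h1⟩ <;> rcases dl_cases o j with ⟨_, h3⟩ | ⟨_, h3⟩ <;>
    rcases dl_cases o l with ⟨h4, h5⟩ | ⟨_, h5⟩ <;> rcases dl_cases o r with ⟨h6, h7⟩ | ⟨_, h7⟩ <;>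
    first | exact ⟨h4, h6⟩ | omega
  rw [hl.1, hl.2]; exact MS.oo h2 X.2 _ _

lemma lo_mono {o : ι} {X : M4 k ι} {v v' : ℤ} (h : lo o X v) (hv : v' ≤ v) : lo o X v' :=
  fun i j l r hw => h i j l r (hw.trans hv)

lemma lo_succ {o : ι} {X : M4 k ι} {v w : ℤ} (h : lo o X v) (hv : w = v + 1)
    (h' : ∀ i j l r, wt o i j l r = w → X (i, j) (l, r) = 0) : lo o X w := by
  intro i j l r hw
  by_cases hh : wt o i j l r = w
  · exact h' _ _ _ _ hh
  · exact h _ _ _ _ (by omega)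

lemma wt_le (o i j l r : ι) : wt o i j l r ≤ 2 := by
  simp only [wt]
  rcases dl_cases o i with ⟨_, h1⟩ | ⟨_, h1⟩ <;> rcases dl_cases o j with ⟨_, h3⟩ | ⟨_, h3⟩ <;>
    rcases dl_cases o l with ⟨h4, h5⟩ | ⟨_, h5⟩ <;> rcases dl_cases o r with ⟨h6, h7⟩ | ⟨_, h7⟩ <;>
    omega

lemma eq_zero_of_lo {o : ι} {X : MS k ι} (h : lo o (X : M4 k ι) 2) : X = 0 := by
  apply Subtype.ext
  ext ⟨i, j⟩ ⟨l, r⟩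
  exact h _ _ _ _ (wt_le _ _ _ _ _)

/-- vanishing of weight 2 part is checked on special coordinates -/
lemma wt2_of {o : ι} {P : ι → ι → ι → ι → Prop} (h : ∀ l r, l ≠ o → r ≠ o → P o o l r) :
    ∀ i j l r, wt o i j l r = 2 → P i j l r := by
  intro i j l r hw
  simp only [wt] at hw
  rcases dl_cases o i with ⟨h1, h2⟩ | ⟨_, h2⟩ <;> rcases dl_cases o j with ⟨h3, h4⟩ | ⟨_, h4⟩ <;>
    rcases dl_cases o l with ⟨h5, h6⟩ | ⟨h5, h6⟩ <;> rcases dl_cases o r with ⟨h7, h8⟩ | ⟨h7, h8⟩ <;>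
    first
    | (subst h1; subst h3; exact h _ _ h5 h7)
    | omega

lemma wt1_of (h2 : (2 : k) ≠ 0) {o : ι} {X : M4 k ι} (hX : X ∈ MS k ι)
    (ha : ∀ l, l ≠ o → X (o, o) (o, l) = 0)
    (hb : ∀ j l r, j ≠ o → l ≠ o → r ≠ o → X (o, j) (l, r) = 0) :
    ∀ i j l r, wt o i j l r = 1 → X (i, j) (l, r) = 0 := by
  intro i j l r hw
  simp only [wt] at hw
  rcases dl_cases o i with ⟨h1, h2⟩ | ⟨h1, h2⟩ <;> rcases dl_cases o j with ⟨h3, h4⟩ | ⟨h3, h4⟩ <;>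
    rcases dl_cases o l with ⟨h5, h6⟩ | ⟨h5, h6⟩ <;> rcases dl_cases o r with ⟨h7, h8⟩ | ⟨h7, h8⟩ <;>
    first
    | omega
    | (subst h1; subst h3; subst h5; exact ha _ h7)
    | (subst h1; subst h3; subst h7; rw [MS.alt hX, ha _ h5, neg_zero])
    | (subst h1; exact hb _ _ _ h3 h5 h7)
    | (subst h3; rw [MS.sym hX]; exact hb _ _ _ h1 h5 h7)

lemma wt0_of (h2 : (2 : k) ≠ 0) {o : ι} {X : M4 k ι} (hX : X ∈ MS k ι)
    (ha : ∀ x l, x ≠ o → l ≠ o → X (o, x) (o, l) = 0)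
    (hb : ∀ x j l r, x ≠ o → j ≠ o → l ≠ o → r ≠ o → X (x, j) (l, r) = 0) :
    ∀ i j l r, wt o i j l r = 0 → X (i, j) (l, r) = 0 := by
  intro i j l r hw
  simp only [wt] at hw
  rcases dl_cases o i with ⟨h1, h2'⟩ | ⟨h1, h2'⟩ <;> rcases dl_cases o j with ⟨h3, h4⟩ | ⟨h3, h4⟩ <;>
    rcases dl_cases o l with ⟨h5, h6⟩ | ⟨h5, h6⟩ <;> rcases dl_cases o r with ⟨h7, h8⟩ | ⟨h7, h8⟩ <;>
    first
    | omega
    | (subst h5; subst h7; exact MS.oo h2 hX _ _)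
    | (subst h1; subst h5; exact ha _ _ h3 h7)
    | (subst h1; subst h7; rw [MS.alt hX, ha _ _ h3 h5, neg_zero])
    | (subst h3; subst h5; rw [MS.sym hX]; exact ha _ _ h1 h7)
    | (subst h3; subst h7; rw [MS.sym hX, MS.alt hX, ha _ _ h1 h5, neg_zero])
    | exact hb _ _ _ _ h1 h3 h5 h7

/-- basis vectors of `AS` (zero at `o`) -/
def E (k : Type) [Field k] {ι : Type} [DecidableEq ι] (o x : ι) : AS k o :=
  ⟨if x = o then 0 else Pi.single x 1, by
    change (if x = o then 0 else Pi.single x 1 : ι → k) o = 0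
    split_ifs with h
    · rfl
    · exact Pi.single_eq_of_ne (Ne.symm h) _⟩

lemma E_self (o : ι) : E k o o = 0 := Subtype.ext (by simp [E])

lemma E_coe {o x : ι} (h : x ≠ o) (y : ι) : (E k o x : ι → k) y = if y = x then 1 else 0 := by
  simp [E, h, Pi.single_apply]

lemma E_sum {o : ι} (a : AS k o) : a = ∑ x, (a : ι → k) x • E k o x := by
  apply Subtype.ext
  ext y
  simp only [AddSubmonoidClass.coe_finsetSum, Finset.sum_apply, Submodule.coe_smul, Pi.smul_apply, smul_eq_mul]
  by_cases hy : y = o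
  · rw [hy, AS.zero, Finset.sum_eq_zero]
    intro x _; rw [AS.zero, mul_zero]
  · rw [Finset.sum_eq_single y]
    · simp [E_coe hy]
    · intro x _ hx
      by_cases h : x = o
      · rw [h, AS.zero, zero_mul]
      · rw [E_coe h]; simp [Ne.symm hx]
    · simp

lemma lin_sum {o : ι} {f : AS k o → k} (hfa : ∀ a b, f (a + b) = f a + f b)
    (hw : ∀ (t : kˣ) a, f ((t : k) • a) = (t : k) * f a) (a : AS k o) :
    f a = ∑ x, (a : ι → k) x * f (E k o x) := by
  have h0 : f 0 = 0 := by simpa using hfa 0 0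
  have ht : ∀ (t : k) a, f (t • a) = t * f a := by
    intro t a
    by_cases h : t = 0
    · rw [h, zero_smul, h0, zero_mul]
    · exact hw (Units.mk0 t h) a
  let F : AS k o →ₗ[k] k := ⟨⟨f, hfa⟩, ht⟩
  change F a = ∑ x, (a : ι → k) x * F (E k o x)
  conv_lhs => rw [E_sum a]
  simp

lemma sumE {o x : ι} (hx : x ≠ o) (F : ι → k) : ∑ y, (E k o x : ι → k) y * F y = F x := by
  simp [E_coe hx]

lemma D1_oool {o : ι} (h2 : (2 : k) ≠ 0) (a : AS k o) {X : M4 k ι} (hX : X ∈ MS k ι) (l : ι) :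
    D1 o a X o o o l = 2 * ∑ x, (a : ι → k) x * X (o, x) (o, l) := by
  have e : ∀ x, X (x, o) (o, l) = X (o, x) (o, l) := fun x => MS.sym hX _ _ _
  simp only [D1, R1, AS.zero, MS.oo h2 hX, e, if_true]
  ring

lemma D1_oolr {o : ι} (a : AS k o) {X : M4 k ι} (hX : X ∈ MS k ι) (l r : ι) :
    D1 o a X o o l r = 2 * ∑ x, (a : ι → k) x * X (o, x) (l, r) - (a : ι → k) l * X (o, o) (o, r)
      + (a : ι → k) r * X (o, o) (o, l) := by
  have e : ∀ x, X (x, o) (l, r) = X (o, x) (l, r) := fun x => MS.sym hX _ _ _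
  have e' : X (o, o) (l, o) = - X (o, o) (o, l) := MS.alt hX _ _ _
  simp only [D1, R1, e, e', if_true]
  ring

lemma D1_ojlr {o : ι} (a : AS k o) {X : M4 k ι} (hX : X ∈ MS k ι) {j : ι} (hj : j ≠ o) (l r : ι) :
    D1 o a X o j l r = ∑ x, (a : ι → k) x * X (x, j) (l, r) - (a : ι → k) l * X (o, j) (o, r)
      + (a : ι → k) r * X (o, j) (o, l) := by
  have e' : X (o, j) (l, o) = - X (o, j) (o, l) := MS.alt hX _ _ _
  simp only [D1, R1, e', if_true, if_neg hj]
  ring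

variable {p : ℕ} [CharP k p] [Fintype k] [DecidableEq k]

lemma two_zpow (hp5 : 5 ≤ p) {w : ℤ} (h : w = -1 ∨ w = 1 ∨ w = 2) : (2 : k) ^ w ≠ 1 := by
  have h2 : (2 : k) ≠ 0 := two_ne hp5
  have c : ∀ m : ℕ, 0 < m → m < 5 → (m : k) ≠ 0 := by
    intro m h0 hm h
    rw [CharP.cast_eq_zero_iff k p] at h
    exact absurd (Nat.le_of_dvd h0 h) (by omega)
  have h3 : (3 : k) ≠ 0 := by exact_mod_cast c 3 (by norm_num) (by norm_num)
  rcases h with rfl | rfl | rfl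
  · intro h
    rw [zpow_neg_one, inv_eq_one] at h
    exact one_ne_zero (by linear_combination h : (1 : k) = 0)
  · intro h
    rw [zpow_one] at h
    exact one_ne_zero (by linear_combination h : (1 : k) = 0)
  · intro h
    have : (2 : k) ^ 2 = 1 := by exact_mod_cast h
    exact h3 (by linear_combination this)

/-- `H⁰` of `N` vanishes. -/
lemma H0N (hp5 : 5 ≤ p) {o : ι} (m : MS k ι) (hu : ∀ a : AS k o, repM k ι (uu a) m = m)
    (hs : ∀ t : kˣ, repM k ι (ss o t) m = m) : m = 0 := by
  have h2 : (2 : k) ≠ 0 := two_ne hp5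
  have key : ∀ i j l r, wt o i j l r = -1 ∨ wt o i j l r = 1 ∨ wt o i j l r = 2 →
      (m : M4 k ι) (i, j) (l, r) = 0 := by
    intro i j l r hw
    have := ss_act o (Units.mk0 2 h2) m i j l r
    rw [hs, Units.val_mk0] at this
    by_contra hne
    exact two_zpow hp5 hw (mul_right_cancel₀ hne (by rw [one_mul]; exact this.symm))
  have l1 : lo o (m : M4 k ι) (-1) := lo_succ (lo_init h2 o m) (by norm_num) fun i j l r h =>
    key _ _ _ _ (Or.inl h)
  have hD : ∀ (a : AS k o) i j l r, wt o i j l r = 1 → D1 o a (m : M4 k ι) i j l r = 0 := by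
    intro a i j l r hw
    have := uu_lo1 h2 a l1 (i := i) (j := j) (l := l) (r := r) (by omega)
    rw [hu] at this
    linear_combination -this
  have a1 : ∀ x l, x ≠ o → l ≠ o → (m : M4 k ι) (o, x) (o, l) = 0 := by
    intro x l hx hl
    have := hD (E k o x) o o o l (by simp only [wt, dl_ne hl, dl_self]; norm_num)
    rw [D1_oool h2 _ m.2, sumE hx] at this
    simpa [h2] using this
  have a2 : ∀ x j l r, x ≠ o → j ≠ o → l ≠ o → r ≠ o → (m : M4 k ι) (x, j) (l, r) = 0 := by
    intro x j l r hx hj hl hr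
    have := hD (E k o x) o j l r (by simp only [wt, dl_ne hl, dl_ne hj, dl_ne hr, dl_self]; norm_num)
    rw [D1_ojlr _ m.2 hj, sumE hx, a1 j l hj hl, a1 j r hj hr] at this
    simpa using this
  have l0 : lo o (m : M4 k ι) 0 := lo_succ l1 (by norm_num) (wt0_of h2 m.2 a1 a2)
  have l1' : lo o (m : M4 k ι) 1 := lo_succ l0 (by norm_num) fun i j l r h =>
    key _ _ _ _ (Or.inr (Or.inl h))
  exact eq_zero_of_lo (lo_succ l1' (by norm_num) fun i j l r h => key _ _ _ _ (Or.inr (Or.inr h)))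

end Weights
end GLC

namespace GLC
section A1
variable {k : Type} [Field k] {ι : Type} [Fintype ι] [DecidableEq ι]

lemma cj {o : ι} (t : kˣ) (a : AS k o) : ss o t * uu a = uu ((t : k) • a) * ss o t := by
  apply Units.ext
  change Matrix.diagonal _ * um o (a : ι → k) = um o ((t : k) • (a : ι → k)) * Matrix.diagonal _
  ext i j
  rw [Matrix.diagonal_mul, Matrix.mul_diagonal]
  by_cases hi : i = o
  · by_cases hj : j = o
    · simp [um, hi, hj, AS.zero]
    · simp [um, hi, hj, Matrix.one_apply, Ne.symm hj]
  · by_cases hj : j = o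
    · simp [um, hi, hj, Matrix.one_apply]
    · simp [um, hi, hj, Matrix.one_apply]

variable {p : ℕ} [CharP k p] [Fintype k] [DecidableEq k]

/-- equivariant twisted 1-cocycle -/
structure T1 {o : ι} (f : AS k o → MS k ι) : Prop where
  coc : ∀ a b, f (a + b) = f a + repM k ι (uu a) (f b)
  eqv : ∀ (t : kˣ) a, f ((t : k) • a) = repM k ι (ss o t) (f a)

lemma T1.lo_add {o : ι} {f : AS k o → MS k ι} (h : T1 f) (h2 : (2 : k) ≠ 0) {w : ℤ}
    (hl : ∀ a, lo o (f a : M4 k ι) (w - 1)) {i j l r : ι} (hw : wt o i j l r = w) (a b : AS k o) :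
    (f (a + b) : M4 k ι) (i, j) (l, r) = (f a : M4 k ι) (i, j) (l, r) + (f b : M4 k ι) (i, j) (l, r) := by
  rw [h.coc, Submodule.coe_add, Matrix.add_apply, uu_lo h2 a (hl b) (by omega)]

lemma T1.step {o : ι} {f : AS k o → MS k ι} (h : T1 f) (hp5 : 5 ≤ p) (w : ℤ)
    (hww : w = -1 ∨ w = 0 ∨ w = 2) (hl : ∀ a, lo o (f a : M4 k ι) (w - 1)) (a : AS k o) :
    lo o (f a : M4 k ι) w := by
  refine lo_succ (hl a) (by ring) fun i j l r hw => ?_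
  refine add_zero_of_weight (p := p) (k := k) (f := fun a => (f a : M4 k ι) (i, j) (l, r)) hp5
    (h.lo_add (two_ne hp5) hl hw) w hww ?_ a
  intro t a
  simp only [h.eqv, ss_act, hw, smul_eq_mul]

/-- column part of the correction -/
def chi (o : ι) (ψ : ι → ι → k) (j l r : ι) : k :=
  if l = o then (if r = o then 0 else ψ j r) else if r = o then - ψ j l else 0

/-- the weight 0 element -/
def mm (o : ι) (ψ : ι → ι → k) (B : ι → ι → ι → ι → k) : M4 k ι := fun q s =>
  if q.1 = o then (if q.2 = o then 0 else chi o ψ q.2 s.1 s.2)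
  else if q.2 = o then chi o ψ q.1 s.1 s.2
  else if s.1 = o then 0 else if s.2 = o then 0 else B q.1 q.2 s.1 s.2

lemma chi_alt (o : ι) (ψ : ι → ι → k) (j l r : ι) : chi o ψ j r l = - chi o ψ j l r := by
  unfold chi; split_ifs <;> simp

lemma mm_mem (o : ι) (ψ : ι → ι → k) (B : ι → ι → ι → ι → k)
    (h1 : ∀ i j l r, i ≠ o → j ≠ o → l ≠ o → r ≠ o → B j i l r = B i j l r)
    (h2 : ∀ i j l r, i ≠ o → j ≠ o → l ≠ o → r ≠ o → B i j r l = - B i j l r) : mm o ψ B ∈ MS k ι := by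
  apply MS.mk
  · intro i j l r
    by_cases hi : i = o <;> by_cases hj : j = o <;> by_cases hl : l = o <;> by_cases hr : r = o <;>
      simp [mm, hi, hj, hl, hr]
    exact h1 _ _ _ _ hi hj hl hr
  · intro i j l r
    by_cases hi : i = o <;> by_cases hj : j = o <;> by_cases hl : l = o <;> by_cases hr : r = o <;>
      simp [mm, hi, hj, hl, hr, chi]
    exact h2 _ _ _ _ hi hj hl hr

lemma mm_wt (o : ι) (ψ : ι → ι → k) (B : ι → ι → ι → ι → k) (i j l r : ι) (h : wt o i j l r ≠ 0) :
    mm o ψ B (i, j) (l, r) = 0 := by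
  contrapose! h
  by_cases hi : i = o <;> by_cases hj : j = o <;> by_cases hl : l = o <;> by_cases hr : r = o <;>
    simp [mm, hi, hj, hl, hr, chi] at h <;> simp [wt, dl, hi, hj, hl, hr]

lemma A1 (hp5 : 5 ≤ p) {o : ι} {f : AS k o → MS k ι} (h : T1 f) :
    ∃ m : MS k ι, (∀ t : kˣ, repM k ι (ss o t) m = m) ∧ ∀ a, f a = repM k ι (uu a) m - m := by
  have h2 : (2 : k) ≠ 0 := two_ne hp5
  have l0 : ∀ a, lo o (f a : M4 k ι) 0 :=
    h.step hp5 0 (by simp) (by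
      simpa using h.step hp5 (-1) (by simp) fun a => by simpa using lo_init h2 o (f a))
  have lin : ∀ i j l r, wt o i j l r = 1 → ∀ a, (f a : M4 k ι) (i, j) (l, r) =
      ∑ x, (a : ι → k) x * (f (E k o x) : M4 k ι) (i, j) (l, r) := by
    intro i j l r hw a
    refine lin_sum (f := fun a => (f a : M4 k ι) (i, j) (l, r)) (h.lo_add h2 (by simpa using l0) hw) ?_ a
    intro t a
    simp only [h.eqv, ss_act, hw, zpow_one]
  have sy : ∀ (a b : AS k o) (l r : ι), l ≠ o → r ≠ o → D1 o a (f b : M4 k ι) o o l r = D1 o b (f a : M4 k ι) o o l r := by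
    intro a b l r hl hr
    have e1 := congrArg (fun X : MS k ι => (X : M4 k ι) (o, o) (l, r)) (h.coc a b)
    have e2 := congrArg (fun X : MS k ι => (X : M4 k ι) (o, o) (l, r)) (h.coc b a)
    have hw : wt o o o l r ≤ 0 + 2 := wt_le _ _ _ _ _
    simp only [Submodule.coe_add, Matrix.add_apply, uu_lo1 h2 _ (l0 _) hw] at e1 e2
    rw [add_comm b a] at e2
    linear_combination e2 - e1
  set ψ : ι → ι → k := fun x l => (f (E k o x) : M4 k ι) (o, o) (o, l) / 2 with hψ
  have hψ2 : ∀ x l, (f (E k o x) : M4 k ι) (o, o) (o, l) = 2 * ψ x l := by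
    intro x l; simp only [hψ]; field_simp
  set B : ι → ι → ι → ι → k := fun x j l r => (f (E k o x) : M4 k ι) (o, j) (l, r)
    + (if x = l then ψ j r else 0) - (if x = r then ψ j l else 0) with hB
  have hm : mm o ψ B ∈ MS k ι := by
    apply mm_mem
    · intro i j l r hi hj hl hr
      have := sy (E k o i) (E k o j) l r hl hr
      rw [D1_oolr _ (f _).2, D1_oolr _ (f _).2, sumE hi, sumE hj, hψ2, hψ2, hψ2, hψ2,
        E_coe hi, E_coe hi, E_coe hj, E_coe hj] at this
      apply mul_left_cancel₀ h2
      simp only [hB, eq_comm (a := i), eq_comm (a := j)]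
      simp only [ite_mul, one_mul, zero_mul] at this
      simp only [mul_sub, mul_add, mul_ite, mul_zero]
      linear_combination this
    · intro i j l r hi hj hl hr
      simp only [hB, MS.alt (f _).2 l r]
      ring
  let m : MS k ι := ⟨mm o ψ B, hm⟩
  have hmw : ∀ i j l r, wt o i j l r ≠ 0 → (m : M4 k ι) (i, j) (l, r) = 0 := mm_wt o ψ B
  have lm : lo o (m : M4 k ι) (-1) := fun i j l r hw => hmw _ _ _ _ (by omega)
  have hms : ∀ t : kˣ, repM k ι (ss o t) m = m := by
    intro t
    apply Subtype.ext
    ext ⟨i, j⟩ ⟨l, r⟩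
    rw [ss_act]
    by_cases hw : wt o i j l r = 0
    · rw [hw, zpow_zero, one_mul]
    · rw [hmw _ _ _ _ hw, mul_zero]
  refine ⟨m, hms, ?_⟩
  let f' : AS k o → MS k ι := fun a => f a - (repM k ι (uu a) m - m)
  have h' : T1 f' := by
    constructor
    · intro a b
      simp only [f', h.coc, map_sub, ← uu_mul, map_mul, Module.End.mul_apply]
      abel
    · intro t a
      have e : repM k ι (uu ((t : k) • a)) m = repM k ι (ss o t) (repM k ι (uu a) m) := by
        rw [← Module.End.mul_apply, ← map_mul, cj, map_mul, Module.End.mul_apply, hms]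
      simp only [f', h.eqv, map_sub, e, hms]
  have l0' : ∀ a, lo o (f' a : M4 k ι) 0 := by
    intro a i j l r hw
    simp only [f', Submodule.coe_sub, Matrix.sub_apply, uu_lo h2 a lm (by omega : wt o i j l r ≤ -1 + 1),
      l0 a _ _ _ _ hw, sub_self]
  have l1' : ∀ a, lo o (f' a : M4 k ι) 1 := by
    intro a
    refine lo_succ (l0' a) (by norm_num) (wt1_of h2 (f' a).2 ?_ ?_)
    · intro l hl
      have hw : wt o o o o l = 1 := by simp only [wt, dl_ne hl, dl_self]; norm_num
      simp only [f', Submodule.coe_sub, Matrix.sub_apply, uu_lo1 h2 a lm (by omega : wt o o o o l ≤ -1 + 2),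
        lin _ _ _ _ hw a, D1_oool h2 a m.2, hψ2]
      rw [Finset.mul_sum, add_sub_cancel_left, ← Finset.sum_sub_distrib]
      refine Finset.sum_eq_zero fun x _ => ?_
      by_cases hx : x = o
      · rw [hx, AS.zero]; ring
      · have : (m : M4 k ι) (o, x) (o, l) = ψ x l := by simp [m, mm, hx, chi, hl]
        rw [this]; ring
    · intro j l r hj hl hr
      have hw : wt o o j l r = 1 := by simp only [wt, dl_ne hl, dl_ne hj, dl_ne hr, dl_self]; norm_num
      simp only [f', Submodule.coe_sub, Matrix.sub_apply, uu_lo1 h2 a lm (by omega : wt o o j l r ≤ -1 + 2),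
        lin _ _ _ _ hw a, D1_ojlr a m.2 hj]
      have e1 : (m : M4 k ι) (o, j) (o, r) = ψ j r := by simp [m, mm, hj, chi, hr]
      have e2 : (m : M4 k ι) (o, j) (o, l) = ψ j l := by simp [m, mm, hj, chi, hl]
      have e3 : ∑ x, (a : ι → k) x * (m : M4 k ι) (x, j) (l, r) =
          ∑ x, (a : ι → k) x * B x j l r := by
        refine Finset.sum_congr rfl fun x _ => ?_
        by_cases hx : x = o
        · rw [hx, AS.zero, zero_mul, zero_mul]
        · simp [m, mm, hx, hj, hl, hr]
      rw [e1, e2, e3]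
      simp only [hB, mul_sub, mul_add, mul_ite, mul_zero, Finset.sum_sub_distrib, Finset.sum_add_distrib,
        Finset.sum_ite_eq', Finset.mem_univ, if_true]
      ring
  intro a
  have := eq_zero_of_lo (h'.step hp5 2 (by simp) (by simpa using l1') a)
  exact sub_eq_zero.mp this

end A1
end GLC

namespace GLC
section A2
variable {k : Type} [Field k] {ι : Type} [Fintype ι] [DecidableEq ι]

/-- equivariant normalized twisted 2-cocycle -/
structure TW {o : ι} (C : AS k o → AS k o → MS k ι) : Prop where
  coc : ∀ a b d, repM k ι (uu a) (C b d) + C a (b + d) = C (a + b) d + C a b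
  eqv : ∀ (t : kˣ) a b, C ((t : k) • a) ((t : k) • b) = repM k ι (ss o t) (C a b)
  z1 : ∀ a, C 0 a = 0
  z2 : ∀ a, C a 0 = 0

/-- twisted differential -/
def dU {o : ι} (φ : AS k o → MS k ι) (a b : AS k o) : MS k ι :=
  repM k ι (uu a) (φ b) - φ (a + b) + φ a

lemma cj_act {o : ι} (t : kˣ) (a : AS k o) (X : MS k ι) :
    repM k ι (uu ((t : k) • a)) (repM k ι (ss o t) X) = repM k ι (ss o t) (repM k ι (uu a) X) := by
  rw [← Module.End.mul_apply, ← map_mul, ← cj, map_mul, Module.End.mul_apply]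

lemma TW.sub_dU {o : ι} {C : AS k o → AS k o → MS k ι} (h : TW C) {φ : AS k o → MS k ι}
    (hφ : ∀ (t : kˣ) a, φ ((t : k) • a) = repM k ι (ss o t) (φ a)) (h0 : φ 0 = 0) :
    TW (fun a b => C a b - dU φ a b) := by
  constructor
  · intro a b d
    have := h.coc a b d
    simp only [dU, map_sub, map_add, ← uu_mul a b, map_mul, Module.End.mul_apply, add_assoc a b d]
    linear_combination (norm := module) this
  · intro t a b
    simp only [dU, h.eqv, map_sub, map_add, hφ, cj_act, ← smul_add]
  · intro a
    simp [h.z1, dU, uu_zero, h0]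
  · intro a
    simp [h.z2, dU, h0]

/-- weight projection (raw) -/
def prM (o : ι) (w : ℤ) (X : M4 k ι) : M4 k ι := fun q s =>
  if wt o q.1 q.2 s.1 s.2 = w then X q s else 0

lemma prM_apply (o : ι) (w : ℤ) (X : M4 k ι) (i j l r : ι) :
    prM o w X (i, j) (l, r) = if wt o i j l r = w then X (i, j) (l, r) else 0 := rfl

/-- weight projection -/
def pr (o : ι) (w : ℤ) : MS k ι →ₗ[k] MS k ι where
  toFun X := ⟨prM o w X, by
    apply MS.mk
    · intro i j l r
      have : wt o j i l r = wt o i j l r := by simp only [wt]; ring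
      simp only [prM_apply, this, MS.sym X.2 i j]
    · intro i j l r
      have : wt o i j r l = wt o i j l r := by simp only [wt]; ring
      simp only [prM_apply, this, MS.alt X.2 l r]
      split_ifs <;> simp⟩
  map_add' X Y := by
    apply Subtype.ext; ext ⟨i, j⟩ ⟨l, r⟩
    simp only [Submodule.coe_add, Matrix.add_apply, prM_apply]
    split_ifs <;> simp
  map_smul' c X := by
    apply Subtype.ext; ext ⟨i, j⟩ ⟨l, r⟩
    simp only [Submodule.coe_smul, Matrix.smul_apply, RingHom.id_apply, prM_apply]
    split_ifs <;> simp

lemma pr_apply (o : ι) (w : ℤ) (X : MS k ι) (i j l r : ι) :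
    (pr o w X : M4 k ι) (i, j) (l, r) = if wt o i j l r = w then (X : M4 k ι) (i, j) (l, r) else 0 := rfl

lemma pr_eq {o : ι} {w : ℤ} {X Y : MS k ι} (h : ∀ i j l r, wt o i j l r = w →
    (X : M4 k ι) (i, j) (l, r) = (Y : M4 k ι) (i, j) (l, r)) : pr o w X = pr o w Y := by
  apply Subtype.ext; ext ⟨i, j⟩ ⟨l, r⟩
  rw [pr_apply, pr_apply]
  split_ifs with hw
  · exact h _ _ _ _ hw
  · rfl

lemma pr_ss (o : ι) (w : ℤ) (t : kˣ) (X : MS k ι) :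
    pr o w (repM k ι (ss o t) X) = ((t : k) ^ w) • pr o w X := by
  apply Subtype.ext; ext ⟨i, j⟩ ⟨l, r⟩
  simp only [pr_apply, Submodule.coe_smul, Matrix.smul_apply, ss_act, smul_eq_mul]
  split_ifs with hw
  · rw [hw]
  · simp

lemma ss_pr (o : ι) (w : ℤ) (t : kˣ) (X : MS k ι) :
    repM k ι (ss o t) (pr o w X) = ((t : k) ^ w) • pr o w X := by
  apply Subtype.ext; ext ⟨i, j⟩ ⟨l, r⟩
  simp only [ss_act, pr_apply, Submodule.coe_smul, Matrix.smul_apply, smul_eq_mul]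
  split_ifs with hw
  · rw [hw]
  · simp

lemma lo_pr (o : ι) (w : ℤ) (X : MS k ι) : lo o (pr o w X : M4 k ι) (w - 1) := by
  intro i j l r hw
  rw [pr_apply, if_neg (by omega)]

lemma pr_idem (o : ι) (w : ℤ) (X : MS k ι) : pr o w (pr o w X) = pr o w X := by
  apply Subtype.ext; ext ⟨i, j⟩ ⟨l, r⟩
  simp only [pr_apply]
  split_ifs <;> rfl

lemma pr_zero_iff {o : ι} {w : ℤ} {X : MS k ι} (h : pr o w X = 0) {i j l r : ι} (hw : wt o i j l r = w) :
    (X : M4 k ι) (i, j) (l, r) = 0 := by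
  have := pr_apply o w X i j l r
  rw [h, if_pos hw] at this
  exact this.symm

variable {p : ℕ} [CharP k p]

lemma TW.pTC {o : ι} {C : AS k o → AS k o → MS k ι} (h : TW C) (h2 : (2 : k) ≠ 0) {w : ℤ}
    (hl : ∀ a b, lo o (C a b : M4 k ι) (w - 1)) : TC fun a b => pr o w (C a b) := by
  intro a b d
  have := congrArg (pr o w) (h.coc a b d)
  rw [map_add, map_add] at this
  rw [← this]
  congr 1
  exact pr_eq fun i j l r hw => (uu_lo h2 a (hl b d) (by omega)).symm

lemma TW.pw {o : ι} {C : AS k o → AS k o → MS k ι} (h : TW C) (w : ℤ) (t : kˣ) (a b : AS k o) :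
    pr o w (C ((t : k) • a) ((t : k) • b)) = ((t : k) ^ w) • pr o w (C a b) := by
  rw [h.eqv, pr_ss]

/-- norm class -/
def FF {o : ι} (p : ℕ) (C : AS k o → AS k o → MS k ι) (a : AS k o) : MS k ι :=
  ∑ i ∈ Finset.range p, C (i • a) a

lemma FF_dU (hp5 : 5 ≤ p) (hp : p.Prime) {o : ι} (φ : AS k o → MS k ι) (a : AS k o) :
    FF p (dU φ) a = 0 := by
  have h1 : ∀ i : ℕ, dU φ (i • a) a = repM k ι (uu (i • a)) (φ a) - (φ ((i + 1) • a) - φ (i • a)) := by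
    intro i; rw [dU, succ_nsmul]; abel
  simp only [FF, h1, Finset.sum_sub_distrib, norm_zero hp5 hp]
  rw [← Finset.sum_sub_distrib, Finset.sum_range_sub (fun i => φ (i • a)), psmul k a]
  simp

lemma FF_sub {o : ι} (C C' : AS k o → AS k o → MS k ι) (a : AS k o) :
    FF p (fun a b => C a b - C' a b) a = FF p C a - FF p C' a := by
  simp [FF, Finset.sum_sub_distrib]

lemma FF_inv (hp5 : 5 ≤ p) (hp : p.Prime) {o : ι} {C : AS k o → AS k o → MS k ι} (h : TW C) (a b : AS k o) :
    repM k ι (uu b) (FF p C a) = FF p C a := by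
  have key : ∀ x y, repM k ι (uu b) (C x y) - C x y = dU (fun x => C b x - C x b) x y := by
    intro x y
    have e1 := h.coc b x y
    have e2 := h.coc x b y
    have e3 := h.coc x y b
    simp only [dU, map_sub]
    rw [add_comm b x] at e1
    rw [add_comm b y] at e2
    linear_combination (norm := module) e1 - e2 + e3
  rw [← sub_eq_zero, ← FF_dU hp5 hp (fun x => C b x - C x b) a]
  simp only [FF, map_sum, ← key, Finset.sum_sub_distrib]

variable [Fintype k] [DecidableEq k]

lemma TW.Fadd {o : ι} {C : AS k o → AS k o → MS k ι} (h : TW C) (hp5 : 5 ≤ p) {w : ℤ}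
    (hl : ∀ a b, lo o (C a b : M4 k ι) (w - 1)) (hs : ∀ a b, pr o w (C a b) = pr o w (C b a)) (a b : AS k o) :
    pr o w (FF p C (a + b)) = pr o w (FF p C a) + pr o w (FF p C b) := by
  have := (h.pTC (two_ne hp5) hl).fadd (p := p) hs (fun a => by rw [h.z1, map_zero]) (psmul k) (psmul k) a b
  simpa only [FF, map_sum] using this

lemma FF_eqv {o : ι} {C : AS k o → AS k o → MS k ι} (h : TW C) (t : kˣ) (a : AS k o) :
    FF p C ((t : k) • a) = repM k ι (ss o t) (FF p C a) := by
  simp only [FF, map_sum, ← h.eqv]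
  refine Finset.sum_congr rfl fun i _ => ?_
  rw [smul_comm]

lemma TW.F0 {o : ι} {C : AS k o → AS k o → MS k ι} (h : TW C) (hp5 : 5 ≤ p) {w : ℤ}
    (hww : w = -1 ∨ w = 0 ∨ w = 2)
    (hl : ∀ a b, lo o (C a b : M4 k ι) (w - 1)) (hs : ∀ a b, pr o w (C a b) = pr o w (C b a)) (a : AS k o) :
    pr o w (FF p C a) = 0 :=
  add_zero_of_weight (p := p) (k := k) (f := fun a => pr o w (FF p C a)) hp5 (h.Fadd hp5 hl hs) w hww
    (fun t a => by rw [FF_eqv h, pr_ss]) a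

lemma TW.step {o : ι} {C : AS k o → AS k o → MS k ι} (h : TW C) (hp5 : 5 ≤ p) (hp : p.Prime) (w : ℤ)
    (hl : ∀ a b, lo o (C a b : M4 k ι) (w - 1)) (hs : ∀ a b, pr o w (C a b) = pr o w (C b a))
    (hf : ∀ a, pr o w (FF p C a) = 0) :
    ∃ φ : AS k o → MS k ι, (∀ (t : kˣ) a, φ ((t : k) • a) = repM k ι (ss o t) (φ a)) ∧ φ 0 = 0 ∧
      ∀ a b, lo o ((C a b - dU φ a b : MS k ι) : M4 k ι) w := by
  have h2 : (2 : k) ≠ 0 := two_ne hp5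
  obtain ⟨φ, h1, h3⟩ := (h.pTC h2 hl).split_eq (p := p) hs (fun a => by rw [h.z1, map_zero]) hp
    (fun a => by simpa only [FF, map_sum] using hf a) w (h.pw w)
  refine ⟨fun a => pr o w (φ a), ?_, ?_, ?_⟩
  · intro t a
    simp only
    rw [h1, map_smul, ss_pr]
  · have := h3 0 0
    simp only [h.z1, map_zero, add_zero, sub_self, zero_add] at this
    simp only [← this, map_zero]
  · intro a b
    have lφ : ∀ a, lo o (pr o w (φ a) : M4 k ι) (w - 1) := fun a => lo_pr o w _
    have e : ∀ i j l r, wt o i j l r ≤ w → (dU (fun a => pr o w (φ a)) a b : M4 k ι) (i, j) (l, r) =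
        (pr o w (φ b) : M4 k ι) (i, j) (l, r) - (pr o w (φ (a + b)) : M4 k ι) (i, j) (l, r)
         + (pr o w (φ a) : M4 k ι) (i, j) (l, r) := by
      intro i j l r hw
      simp only [dU, Submodule.coe_add, Submodule.coe_sub, Matrix.add_apply, Matrix.sub_apply,
        uu_lo h2 a (lφ b) (by omega : wt o i j l r ≤ w - 1 + 1)]
    refine lo_succ (v := w - 1) ?_ (by ring) ?_
    · intro i j l r hw
      rw [Submodule.coe_sub, Matrix.sub_apply, e _ _ _ _ (by omega), hl a b _ _ _ _ hw,
        lφ _ _ _ _ _ hw, lφ _ _ _ _ _ hw, lφ _ _ _ _ _ hw]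
      simp
    · intro i j l r hw
      have := congrArg (fun X : MS k ι => (X : M4 k ι) (i, j) (l, r)) (h3 a b)
      simp only [Submodule.coe_add, Submodule.coe_sub, Matrix.add_apply, Matrix.sub_apply, pr_apply,
        if_pos hw] at this
      rw [Submodule.coe_sub, Matrix.sub_apply, e _ _ _ _ (by omega), this]
      simp only [pr_apply, if_pos hw, sub_self]

/-- weight 1 element -/
def th (o : ι) (B : ι → ι → ι → k) : M4 k ι := fun q s =>
  if s.1 = o then 0 else if s.2 = o then 0 else
  if q.1 = o then (if q.2 = o then 0 else B q.2 s.1 s.2)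
  else if q.2 = o then B q.1 s.1 s.2 else 0

lemma th_mem (o : ι) (B : ι → ι → ι → k) (h2 : ∀ j l r, B j r l = - B j l r) : th o B ∈ MS k ι := by
  apply MS.mk
  · intro i j l r
    by_cases hi : i = o <;> by_cases hj : j = o <;> by_cases hl : l = o <;> by_cases hr : r = o <;>
      simp [th, hi, hj, hl, hr]
  · intro i j l r
    by_cases hi : i = o <;> by_cases hj : j = o <;> by_cases hl : l = o <;> by_cases hr : r = o <;>
      simp [th, hi, hj, hl, hr, h2 _ l r]

lemma th_wt (o : ι) (B : ι → ι → ι → k) (i j l r : ι) (h : wt o i j l r ≠ 1) :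
    th o B (i, j) (l, r) = 0 := by
  contrapose! h
  by_cases hi : i = o <;> by_cases hj : j = o <;> by_cases hl : l = o <;> by_cases hr : r = o <;>
    simp [th, hi, hj, hl, hr] at h <;> simp [wt, dl, hi, hj, hl, hr]

/-- the class splits -/
def Spl {o : ι} (C : AS k o → AS k o → MS k ι) : Prop :=
  ∃ φ : AS k o → MS k ι, (∀ (t : kˣ) a, φ ((t : k) • a) = repM k ι (ss o t) (φ a)) ∧ φ 0 = 0 ∧
      ∀ a b, C a b = dU φ a b

lemma Spl.of {o : ι} {C : AS k o → AS k o → MS k ι} {φ : AS k o → MS k ι}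
    (h1 : ∀ (t : kˣ) a, φ ((t : k) • a) = repM k ι (ss o t) (φ a)) (h2 : φ 0 = 0)
    (h : Spl fun a b => C a b - dU φ a b) : Spl C := by
  obtain ⟨φ', h3, h4, h5⟩ := h
  refine ⟨fun a => φ a + φ' a, fun t a => by simp only [h1, h3, map_add], by simp [h2, h4], ?_⟩
  intro a b
  have := h5 a b
  simp only [dU, map_add] at this ⊢
  linear_combination (norm := module) this

lemma A2_two (hp5 : 5 ≤ p) (hp : p.Prime) {o : ι} {C : AS k o → AS k o → MS k ι} (h : TW C)
    (hl : ∀ a b, lo o (C a b : M4 k ι) 1) (hs : ∀ a b, pr o 2 (C a b) = pr o 2 (C b a)) : Spl C := by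
  have hl' : ∀ a b, lo o (C a b : M4 k ι) (2 - 1) := by simpa using hl
  obtain ⟨φ, h1, h2, h3⟩ := h.step hp5 hp 2 hl' hs (h.F0 hp5 (by simp) hl' hs)
  exact ⟨φ, h1, h2, fun a b => sub_eq_zero.mp (eq_zero_of_lo (h3 a b))⟩

lemma A2_one (hp5 : 5 ≤ p) (hp : p.Prime) {o : ι} {C : AS k o → AS k o → MS k ι} (h : TW C)
    (hl : ∀ a b, lo o (C a b : M4 k ι) 1) : Spl C := by
  have h2 : (2 : k) ≠ 0 := two_ne hp5
  have hl' : ∀ a b, lo o (C a b : M4 k ι) (2 - 1) := by simpa using hl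
  have tc := h.pTC h2 hl'
  set W : AS k o → AS k o → MS k ι := fun a b => pr o 2 (C a b) - pr o 2 (C b a) with hW
  have W1 : ∀ a b d, W (a + b) d = W a d + W b d := fun a b d => tc.om a b d
  have Wa : ∀ a b, W a b = - W b a := fun a b => by simp only [hW]; abel
  have W2 : ∀ a b d, W d (a + b) = W d a + W d b := fun a b d => by
    rw [Wa, W1, Wa a d, Wa b d]; abel
  have hw : ∀ (t : kˣ) a b, W ((t : k) • a) ((t : k) • b) = ((t : k) ^ (2 : ℤ)) • W a b := by
    intro t a b
    simp only [hW, h.pw, smul_sub]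
  have Ws : ∀ (t : k) a b, W (t • a) b = t • W a b := bilin_of_weight W1 W2 hw
  have Ws2 : ∀ (t : k) a b, W b (t • a) = t • W b a := fun t a b => by rw [Wa, Ws, Wa a b]; simp
  let B : AS k o → ι → ι → ι → k := fun b x l r => (W (E k o x) b : M4 k ι) (o, o) (l, r) / 4
  have hB : ∀ b j l r, B b j r l = - B b j l r := by
    intro b j l r
    simp only [B, MS.alt (W _ _).2 l r]; ring
  let θ : AS k o → MS k ι := fun b => ⟨th o (B b), th_mem o _ (hB b)⟩
  have θw : ∀ b i j l r, wt o i j l r ≠ 1 → (θ b : M4 k ι) (i, j) (l, r) = 0 := fun b => th_wt o (B b)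
  have θadd : ∀ a b, θ (a + b) = θ a + θ b := by
    intro a b
    apply Subtype.ext; ext ⟨i, j⟩ ⟨l, r⟩
    simp only [θ, th, Submodule.coe_add, Matrix.add_apply, B, W2]
    split_ifs <;> ring
  have θs : ∀ (t : k) a, θ (t • a) = t • θ a := by
    intro t a
    apply Subtype.ext; ext ⟨i, j⟩ ⟨l, r⟩
    simp only [θ, th, Submodule.coe_smul, Matrix.smul_apply, B, Ws2, smul_eq_mul]
    split_ifs <;> ring
  have θe : ∀ (t : kˣ) a, θ ((t : k) • a) = repM k ι (ss o t) (θ a) := by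
    intro t a
    rw [θs]
    apply Subtype.ext; ext ⟨i, j⟩ ⟨l, r⟩
    rw [ss_act, Submodule.coe_smul, Matrix.smul_apply, smul_eq_mul]
    by_cases hw : wt o i j l r = 1
    · rw [hw, zpow_one]
    · rw [θw _ _ _ _ _ hw, mul_zero, mul_zero]
  have θ0 : θ 0 = 0 := by simpa using θadd 0 0
  have lθ : ∀ a, lo o (θ a : M4 k ι) 0 := fun a i j l r hw => θw _ _ _ _ _ (by omega)
  have dθ : ∀ a b i j l r, (dU θ a b : M4 k ι) (i, j) (l, r) = D1 o a (θ b : M4 k ι) i j l r := by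
    intro a b i j l r
    simp only [dU, θadd, Submodule.coe_add, Submodule.coe_sub, Matrix.add_apply, Matrix.sub_apply,
        uu_lo1 h2 a (lθ b) (wt_le o i j l r : wt o i j l r ≤ 0 + 2)]
    ring
  refine Spl.of θe θ0 (A2_two hp5 hp (h.sub_dU θe θ0) ?_ ?_)
  · intro a b i j l r hw
    rw [Submodule.coe_sub, Matrix.sub_apply, hl _ _ _ _ _ _ hw, dθ, D1_zero (AS.zero a), sub_zero]
    intro i' j' l' r' h'
    exact lθ _ _ _ _ _ (by omega)
  · have h4 : (4 : k) ≠ 0 := by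
      have : (4 : k) = 2 * 2 := by norm_num
      rw [this]; exact mul_ne_zero h2 h2
    have key : ∀ a b l r, l ≠ o → r ≠ o → (dU θ a b : M4 k ι) (o, o) (l, r) =
        (W a b : M4 k ι) (o, o) (l, r) / 2 := by
      intro a b l r hl hr
      have e1 : ∀ x, (θ b : M4 k ι) (o, o) (o, x) = 0 := fun x => by simp [θ, th]
      rw [dθ, D1_oolr _ (θ b).2, e1, e1]
      have e2 := lin_sum (f := fun a => (W a b : M4 k ι) (o, o) (l, r)) (fun a₁ a₂ => by
        simp only [W1, Submodule.coe_add, Matrix.add_apply]) (fun t a => by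
        simp only [Ws, Submodule.coe_smul, Matrix.smul_apply, smul_eq_mul]) a
      rw [e2, Finset.mul_sum, Finset.sum_div]
      rw [mul_zero, mul_zero, sub_zero, add_zero]
      refine Finset.sum_congr rfl fun x _ => ?_
      by_cases hx : x = o
      · rw [hx, AS.zero]; ring
      · have : (θ b : M4 k ι) (o, x) (l, r) = B b x l r := by simp [θ, th, hl, hr, hx]
        rw [this]; simp only [B]
        field_simp; ring
    intro a b
    refine pr_eq (wt2_of (P := fun i j l r => ((C a b - dU θ a b : MS k ι) : M4 k ι) (i, j) (l, r) =
      ((C b a - dU θ b a : MS k ι) : M4 k ι) (i, j) (l, r)) fun l r hl hr => ?_)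
    have hw : wt o o o l r = 2 := by simp only [wt, dl_ne hl, dl_ne hr, dl_self]; norm_num
    simp only [Submodule.coe_sub, Matrix.sub_apply, key _ _ _ _ hl hr, hW, pr_apply, if_pos hw]
    field_simp; ring

lemma A2_zero (hp5 : 5 ≤ p) (hp : p.Prime) {o : ι} {C : AS k o → AS k o → MS k ι} (h : TW C)
    (hl : ∀ a b, lo o (C a b : M4 k ι) 0)
    (hF : ∀ x l, x ≠ o → l ≠ o → (FF p C (E k o x) : M4 k ι) (o, o) (o, l) = 0) : Spl C := by
  have h2 : (2 : k) ≠ 0 := two_ne hp5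
  have hl' : ∀ a b, lo o (C a b : M4 k ι) (1 - 1) := by simpa using hl
  have hs := (h.pTC h2 hl').om_zero hp5 hp 1 (by simp) (h.pw 1)
  have lF : ∀ a, lo o (FF p C a : M4 k ι) 0 := by
    intro a i j l r hw
    rw [FF, AddSubmonoidClass.coe_finsetSum, Matrix.sum_apply]
    exact Finset.sum_eq_zero fun i _ => hl _ _ _ _ _ _ hw
  have FE : ∀ x, x ≠ o → ∀ i j l r, wt o i j l r = 1 → (FF p C (E k o x) : M4 k ι) (i, j) (l, r) = 0 := by
    intro x hx
    refine wt1_of h2 (FF p C (E k o x)).2 (fun l hl => hF x l hx hl) ?_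
    intro j l r hj hl hr
    have e1 := uu_lo1 h2 (E k o j) (lF (E k o x)) (wt_le o o o l r : wt o o o l r ≤ 0 + 2)
    rw [FF_inv hp5 hp h, D1_oolr _ (FF p C (E k o x)).2, sumE hj, hF x l hx hl, hF x r hx hr] at e1
    have : 2 * (FF p C (E k o x) : M4 k ι) (o, j) (l, r) = 0 := by linear_combination -e1
    simpa [h2] using this
  have F0 : ∀ a, pr o 1 (FF p C a) = 0 := by
    intro a
    apply Subtype.ext; ext ⟨i, j⟩ ⟨l, r⟩
    rw [pr_apply]
    split_ifs with hw
    · have := lin_sum (f := fun a => (pr o 1 (FF p C a) : M4 k ι) (i, j) (l, r)) (fun a b => by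
        simp only [h.Fadd hp5 hl' hs, Submodule.coe_add, Matrix.add_apply]) (fun t a => by
        simp only [FF_eqv h, pr_ss, Submodule.coe_smul, Matrix.smul_apply, smul_eq_mul, zpow_one]) a
      simp only [pr_apply, if_pos hw] at this
      rw [this]
      refine Finset.sum_eq_zero fun x _ => ?_
      by_cases hx : x = o
      · rw [hx, AS.zero, zero_mul]
      · rw [FE x hx _ _ _ _ hw, mul_zero]
    · rfl
  obtain ⟨φ, h1, h3, h4⟩ := h.step hp5 hp 1 hl' hs F0
  exact Spl.of h1 h3 (A2_one hp5 hp (h.sub_dU h1 h3) h4)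

lemma A2 (hp5 : 5 ≤ p) (hp : p.Prime) {o : ι} {C : AS k o → AS k o → MS k ι} (h : TW C)
    (hF : ∀ x l, x ≠ o → l ≠ o → (FF p C (E k o x) : M4 k ι) (o, o) (o, l) = 0) : Spl C := by
  have h2 : (2 : k) ≠ 0 := two_ne hp5
  have l1 : ∀ a b, lo o (C a b : M4 k ι) (-1 - 1) := fun a b => by simpa using lo_init h2 o (C a b)
  have s1 := (h.pTC h2 l1).om_zero hp5 hp (-1) (by simp) (h.pw _)
  obtain ⟨φ, h1, h3, h4⟩ := h.step hp5 hp (-1) l1 s1 (h.F0 hp5 (by simp) l1 s1)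
  refine Spl.of h1 h3 ?_
  have t1 := h.sub_dU h1 h3
  have l2 : ∀ a b, lo o ((C a b - dU φ a b : MS k ι) : M4 k ι) (0 - 1) := by simpa using h4
  have s2 := (t1.pTC h2 l2).om_zero hp5 hp 0 (by simp) (t1.pw _)
  obtain ⟨φ', h1', h3', h4'⟩ := t1.step hp5 hp 0 l2 s2 (t1.F0 hp5 (by simp) l2 s2)
  refine Spl.of h1' h3' (A2_zero hp5 hp (t1.sub_dU h1' h3') h4' ?_)
  intro x l hx hl
  rw [FF_sub, FF_sub, FF_dU hp5 hp, FF_dU hp5 hp, sub_zero, sub_zero]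
  exact hF x l hx hl

end A2
end GLC

namespace GLC
section Grp
variable {k : Type} [Field k] {ι : Type} [Fintype ι] [DecidableEq ι]

lemma ss_mul (o : ι) (t t' : kˣ) : ss o t * ss o t' = ss (k := k) o (t * t') := by
  apply Units.ext
  change Matrix.diagonal _ * Matrix.diagonal _ = Matrix.diagonal _
  rw [Matrix.diagonal_mul_diagonal]
  congr 1; ext i
  by_cases h : i = o <;> simp [h]

lemma ss_one (o : ι) : ss o (1 : kˣ) = 1 := by
  apply Units.ext
  change Matrix.diagonal _ = 1
  simp

/-- `ss` as a homomorphism -/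
def ssH (k : Type) [Field k] (o : ι) : kˣ →* GL ι k where
  toFun := ss o
  map_one' := ss_one o
  map_mul' t t' := (ss_mul o t t').symm

lemma ssH_inj (o : ι) : Function.Injective (ssH k o) := by
  intro t t' h
  have := congrArg (fun g : GL ι k => (g : Matrix ι ι k) o o) h
  simp only [ssH, ss, dg, MonoidHom.coe_mk, OneHom.coe_mk, Matrix.diagonal_apply_eq, if_true] at this
  exact Units.ext this

/-- the torus -/
def SS (k : Type) [Field k] (o : ι) : Subgroup (GL ι k) := (ssH k o).range

lemma mem_SS (o : ι) (t : kˣ) : ss o t ∈ SS k o := ⟨t, rfl⟩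

/-- the normal subgroup of the parabolic -/
def NN (k : Type) [Field k] (o : ι) : Subgroup (GL ι k) where
  carrier := {g | ∃ (a : AS k o) (t : kˣ), g = uu a * ss o t}
  mul_mem' := by
    rintro _ _ ⟨a, t, rfl⟩ ⟨b, t', rfl⟩
    refine ⟨a + (t : k) • b, t * t', ?_⟩
    rw [← uu_mul, ← ss_mul, mul_assoc, ← mul_assoc (ss o t), cj]
    simp only [mul_assoc]
  one_mem' := ⟨0, 1, by rw [uu_zero, ss_one, one_mul]⟩
  inv_mem' := by
    rintro _ ⟨a, t, rfl⟩
    refine ⟨((t⁻¹ : kˣ) : k) • (-a), t⁻¹, ?_⟩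
    rw [← cj, inv_eq_iff_mul_eq_one, mul_assoc, ← mul_assoc (ss o t), ss_mul, mul_inv_cancel, ss_one,
      one_mul, uu_mul, add_neg_cancel, uu_zero]

lemma NN_val (o : ι) (a : AS k o) (t : kˣ) : ((uu a * ss o t : GL ι k) : Matrix ι ι k) =
    um o fun j => if j = o then (t : k) - 1 else (a : ι → k) j := by
  change um o (a : ι → k) * Matrix.diagonal _ = _
  ext i j
  rw [Matrix.mul_diagonal]
  by_cases hi : i = o
  · by_cases hj : j = o
    · simp [um, hi, hj, AS.zero]
    · simp [um, hi, hj, Matrix.one_apply, Ne.symm hj]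
  · by_cases hj : j = o
    · simp [um, hi, hj, Matrix.one_apply]
    · simp [um, hi, hj, Matrix.one_apply]

lemma mem_NN_of {o : ι} {g : GL ι k} {r : ι → k} (h : (g : Matrix ι ι k) = um o r) : g ∈ NN k o := by
  have h1 : (1 : k) + r o ≠ 0 := by
    intro h0
    have e : ((g⁻¹ : GL ι k) : Matrix ι ι k) * (g : Matrix ι ι k) = 1 := by
      rw [← Units.val_mul, inv_mul_cancel, Units.val_one]
    have e1 := congrFun (congrFun e o) o
    rw [h, Matrix.mul_apply, Finset.sum_eq_zero] at e1
    · simp at e1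
    · intro x _
      by_cases hx : x = o
      · simp [um, hx, h0]
      · simp [um, hx, Matrix.one_apply]
  refine ⟨⟨fun j => if j = o then 0 else r j, by simp [AS]⟩, Units.mk0 _ h1, Units.ext ?_⟩
  rw [NN_val, h]
  congr 1
  ext j
  by_cases hj : j = o <;> simp [hj]

/-- vectors with the GL action -/
abbrev Vc (k ι : Type) := ι → k

instance : MulAction (GL ι k) (Vc k ι) where
  smul g v := ((g : Matrix ι ι k).mulVec v : ι → k)
  one_smul v := by
    change (((1 : GL ι k) : Matrix ι ι k).mulVec v : ι → k) = v
    simp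
  mul_smul g h v := by
    change (((g * h : GL ι k) : Matrix ι ι k).mulVec v : ι → k) = (g : Matrix ι ι k).mulVec ((h : Matrix ι ι k).mulVec v)
    simp

lemma Vc_smul (g : GL ι k) (v : Vc k ι) : g • v = ((g : Matrix ι ι k).mulVec v : ι → k) := rfl

/-- base vector -/
def eo (o : ι) : Vc k ι := (Pi.single o 1 : ι → k)

lemma um_vec (o : ι) (r : ι → k) : um o r = 1 + Matrix.vecMulVec (Pi.single o 1) r := by
  ext i j
  by_cases h : i = o <;> simp [um, Matrix.vecMulVec_apply, h]

/-- the parabolic -/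
def PP (k : Type) [Field k] (o : ι) : Subgroup (GL ι k) where
  carrier := {g | ∀ n, n ∈ NN k o ↔ g * n * g⁻¹ ∈ NN k o}
  one_mem' := by intro n; simp
  mul_mem' := by
    intro g h hg hh n
    rw [hh n, hg]
    simp only [mul_assoc, mul_inv_rev]
  inv_mem' := by
    intro g hg n
    rw [hg (g⁻¹ * n * g⁻¹⁻¹)]
    simp only [mul_assoc, inv_inv, mul_inv_cancel, mul_one, mul_inv_cancel_left]

lemma stab_conj {o : ι} {g : GL ι k} (hg : g • (eo o : Vc k ι) = eo o) {n : GL ι k} (hn : n ∈ NN k o) :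
    g * n * g⁻¹ ∈ NN k o := by
  obtain ⟨a, t, rfl⟩ := hn
  have e := NN_val o a t
  set r : ι → k := fun j => if j = o then (t : k) - 1 else (a : ι → k) j
  refine mem_NN_of (r := Matrix.vecMul r ((g⁻¹ : GL ι k) : Matrix ι ι k)) ?_
  have hg' : (g : Matrix ι ι k).mulVec (Pi.single o 1) = Pi.single o 1 := hg
  rw [Units.val_mul, Units.val_mul, e, um_vec, um_vec, mul_add, add_mul, mul_one, Matrix.mul_vecMulVec,
    Matrix.vecMulVec_mul, hg', ← Units.val_mul, mul_inv_cancel, Units.val_one]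

lemma stab_le (o : ι) : MulAction.stabilizer (GL ι k) (eo o : Vc k ι) ≤ PP k o := by
  intro g hg n
  have hg' : g • (eo o : Vc k ι) = eo o := hg
  refine ⟨stab_conj hg', fun h => ?_⟩
  have h2 : g⁻¹ • (eo o : Vc k ι) = eo o := by rw [inv_smul_eq_iff]; exact hg'.symm
  have := stab_conj h2 h
  simpa [mul_assoc] using this

lemma NN_le (o : ι) : NN k o ≤ PP k o := by
  intro g hg n
  rw [Subgroup.mul_mem_cancel_right _ (inv_mem hg), Subgroup.mul_mem_cancel_left _ hg]

lemma orbit_eo (o : ι) : MulAction.orbit (GL ι k) (eo o : Vc k ι) = {v : Vc k ι | v = (0 : ι → k)}ᶜ := by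
  have A : ∀ v : Vc k ι, v o ≠ 0 → v ∈ MulAction.orbit (GL ι k) (eo o : Vc k ι) := by
    intro v hv
    have hd : (Matrix.updateCol (1 : Matrix ι ι k) o v).det ≠ 0 := by
      have : (Matrix.updateCol (1 : Matrix ι ι k) o v).det = v o := by
        rw [← Matrix.cramer_apply, Matrix.cramer_one]; rfl
      rwa [this]
    refine ⟨Matrix.GeneralLinearGroup.mkOfDetNeZero _ hd, ?_⟩
    change (Matrix.updateCol (1 : Matrix ι ι k) o v).mulVec (Pi.single o 1) = v
    rw [Matrix.mulVec_single_one]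
    ext i; simp [Matrix.col]
  ext v
  constructor
  · rintro ⟨g, rfl⟩ h
    have h : g • (eo o : Vc k ι) = (0 : ι → k) := h
    have h3 : (eo o : Vc k ι) = g⁻¹ • (0 : Vc k ι) := by
      rw [← show g • (eo o : Vc k ι) = 0 from h, inv_smul_smul]
    have h4 := congrFun h3 o
    rw [Vc_smul, Matrix.mulVec_zero] at h4
    simp [eo] at h4
  · intro hv
    have : ∃ x, v x ≠ 0 := by
      by_contra! h
      exact hv (funext h)
    obtain ⟨x, hx⟩ := this
    have hmem := A (pm (k := k) (Equiv.swap o x) • v) ?_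
    · obtain ⟨g, hg⟩ := hmem
      refine ⟨(pm (k := k) (Equiv.swap o x))⁻¹ * g, ?_⟩
      change ((pm (k := k) (Equiv.swap o x))⁻¹ * g) • (eo o : Vc k ι) = v
      rw [mul_smul, inv_smul_eq_iff]; exact hg
    rw [Vc_smul]
    simpa [pm, Matrix.mulVec, dotProduct, Matrix.one_apply] using hx

variable [Fintype k] [DecidableEq k]

lemma index_ne [Nonempty ι] (o : ι) : ((PP k o).index : k) ≠ 0 := by
  obtain ⟨d, hd⟩ := Subgroup.index_dvd_of_le (stab_le (k := k) o)
  intro h0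
  have h1 : ((MulAction.stabilizer (GL ι k) (eo o : Vc k ι)).index : k) = 0 := by
    rw [hd, Nat.cast_mul, h0, zero_mul]
  rw [MulAction.index_stabilizer, orbit_eo] at h1
  have : Finite (Vc k ι) := inferInstanceAs (Finite (ι → k))
  have h2 := Set.ncard_add_ncard_compl {v : Vc k ι | v = (0 : ι → k)}
  have h3 : {v : Vc k ι | v = (0 : ι → k)}.ncard = 1 := Set.ncard_singleton _
  have h4 : Nat.card (Vc k ι) = Fintype.card k ^ Fintype.card ι := by
    change Nat.card (ι → k) = _
    rw [Nat.card_eq_fintype_card, Fintype.card_fun]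
  rw [h3, h4] at h2
  have h5 := congrArg (Nat.cast (R := k)) h2
  rw [Nat.cast_add, h1, Nat.cast_pow, Nat.cast_card_eq_zero, zero_pow Fintype.card_ne_zero] at h5
  simp at h5

end Grp
end GLC

namespace GLC
section Main
variable {k : Type} [Field k] {ι : Type} [Fintype ι] [DecidableEq ι]
variable {p : ℕ} [CharP k p] [Fintype k] [DecidableEq k]

lemma H0N' (hp5 : 5 ≤ p) (o : ι) (m : MS k ι) (h : ∀ n ∈ NN k o, repM k ι n m = m) : m = 0 :=
  H0N (p := p) hp5 m (fun a => h _ ⟨a, 1, by rw [ss_one, mul_one]⟩)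
    (fun t => h _ ⟨0, t, by rw [uu_zero, one_mul]⟩)

lemma uu_mem {o : ι} (a : AS k o) : uu a ∈ NN k o := ⟨a, 1, by rw [ss_one, mul_one]⟩
lemma ss_mem (o : ι) (t : kˣ) : ss o t ∈ NN k o := ⟨0, t, by rw [uu_zero, one_mul]⟩

lemma H1N (hp5 : 5 ≤ p) (o : ι) (f : GL ι k → MS k ι)
    (hf : ∀ n ∈ NN k o, ∀ n' ∈ NN k o, f (n * n') = f n + repM k ι n (f n')) :
    ∃ m, ∀ n ∈ NN k o, f n = repM k ι n m - m := by
  set m0 : MS k ι := -((Fintype.card kˣ : k)⁻¹ • ∑ t : kˣ, f (ss o t)) with hm0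
  have hS : ∀ t : kˣ, f (ss o t) = repM k ι (ss o t) m0 - m0 := by
    intro t
    have e : ∑ t' : kˣ, f (ss o (t * t')) = ∑ t' : kˣ, f (ss o t') :=
      Fintype.sum_equiv (Equiv.mulLeft t) _ _ fun _ => rfl
    have e2 : ∀ t', f (ss o (t * t')) = f (ss o t) + repM k ι (ss o t) (f (ss o t')) := by
      intro t'
      rw [← ss_mul, hf _ (ss_mem o t) _ (ss_mem o t')]
    simp only [e2, Finset.sum_add_distrib, Finset.sum_const, Finset.card_univ, ← map_sum,
      ← Nat.cast_smul_eq_nsmul k] at e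
    have hc := card_units_ne (k := k)
    have e3 : f (ss o t) = (Fintype.card kˣ : k)⁻¹ • ((Fintype.card kˣ : k) • f (ss o t)) := by
      rw [smul_smul, inv_mul_cancel₀ hc, one_smul]
    rw [e3, eq_sub_of_add_eq e, hm0, map_neg, map_smul, smul_sub]
    abel
  let f' : GL ι k → MS k ι := fun g => f g - (repM k ι g m0 - m0)
  have hf' : ∀ n ∈ NN k o, ∀ n' ∈ NN k o, f' (n * n') = f' n + repM k ι n (f' n') := by
    intro n hn n' hn'
    simp only [f', hf n hn n' hn', map_sub, map_mul, Module.End.mul_apply]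
    abel
  have f's : ∀ t : kˣ, f' (ss o t) = 0 := by
    intro t; simp only [f', hS, sub_self]
  have T : T1 (o := o) fun a => f' (uu a) := by
    constructor
    · intro a b
      simp only [← uu_mul a b, hf' _ (uu_mem a) _ (uu_mem b)]
    · intro t a
      have e1 := hf' _ (uu_mem ((t : k) • a)) _ (ss_mem o t)
      have e2 := hf' _ (ss_mem o t) _ (uu_mem a)
      rw [cj, e1] at e2
      simp only [f's, map_zero, add_zero, zero_add] at e2
      exact e2
  obtain ⟨m, h1, h2⟩ := A1 (p := p) hp5 T
  refine ⟨m0 + m, ?_⟩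
  rintro _ ⟨a, t, rfl⟩
  have e1 := hf' _ (uu_mem a) _ (ss_mem o t)
  rw [f's, map_zero, add_zero, h2] at e1
  have e2 : f (uu a * ss o t) = f' (uu a * ss o t) + (repM k ι (uu a * ss o t) m0 - m0) := by
    simp only [f']; abel
  rw [e2, e1, map_add, map_mul, Module.End.mul_apply, Module.End.mul_apply, h1]
  abel

lemma H1G (hp5 : 5 ≤ p) (o : ι) (f : GL ι k → MS k ι)
    (hf : ∀ g h, f (g * h) = f g + repM k ι g (f h)) : ∃ m, ∀ g, f g = repM k ι g m - m := by
  obtain ⟨m, hm⟩ := H1N (p := p) hp5 o f (fun n _ n' _ => hf n n')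
  have : Nonempty ι := ⟨o⟩
  exact L5 hf (NN k o) (PP k o) (fun g hg n hn => (hg n).mp hn) (H0N' (p := p) hp5 o) (index_ne o) m hm

/-- restriction to the unipotent group -/
def resA (o : ι) (c : GL ι k → GL ι k → MS k ι) (a b : AS k o) : MS k ι := c (uu a) (uu b)

/-- unipotent part -/
def aOf (o : ι) (g : GL ι k) : AS k o := ⟨fun j => if j = o then 0 else (g : Matrix ι ι k) o j, by simp [AS]⟩

lemma aOf_eq {o : ι} (a : AS k o) (t : kˣ) : aOf o (uu a * ss o t) = a := by
  apply Subtype.ext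
  ext j
  simp only [aOf, NN_val]
  by_cases hj : j = o
  · simp [hj, AS.zero]
  · simp [um, hj, Matrix.one_apply, Ne.symm hj]

lemma resA_dd (o : ι) (b : GL ι k → MS k ι) : resA o (dd (repM k ι) b) = dU fun a => b (uu a) := by
  ext1 x; ext1 y
  simp only [resA, dd, dU, uu_mul]

lemma H2N (hp5 : 5 ≤ p) (hp : p.Prime) (o : ι) {c : GL ι k → GL ι k → MS k ι} (hc : Coc (repM k ι) c)
    (hF : ∀ x l, x ≠ o → l ≠ o → (FF p (resA o c) (E k o x) : M4 k ι) (o, o) (o, l) = 0) :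
    ∃ b, ∀ g ∈ NN k o, ∀ h ∈ NN k o, c g h = dd (repM k ι) b g h := by
  classical
  letI : Fintype (SS k o) := Fintype.ofFinite _
  have hcard : (Fintype.card (SS k o) : k) ≠ 0 := by
    have e : Fintype.card (SS k o) = Fintype.card kˣ :=
      Fintype.card_congr (show SS k o ≃ kˣ from (MonoidHom.ofInjective (ssH_inj (k := k) o)).toEquiv.symm)
    rw [e]
    exact card_units_ne
  obtain ⟨b0, hb1, hb2⟩ := L4 hc (SS k o) hcard
  set c' : GL ι k → GL ι k → MS k ι := fun g h => c g h - dd (repM k ι) b0 g h with hc'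
  have cc : Coc (repM k ι) c' := hc.sub (coc_dd _ b0)
  have z1 : ∀ g t, c' g (ss o t) = 0 := fun g t => sub_eq_zero.mpr (hb1 g _ (mem_SS o t))
  have z2 : ∀ g t, c' (ss o t) g = 0 := fun g t => sub_eq_zero.mpr (hb2 g _ (mem_SS o t))
  have q1 : ∀ g h t, c' (g * ss o t) h = c' g (ss o t * h) := by
    intro g h t
    have := cc g (ss o t) h
    rw [z1, z2, map_zero, zero_add, add_zero] at this
    exact this.symm
  have q2 : ∀ g h t, c' g (h * ss o t) = c' g h := by
    intro g h t
    have := cc g h (ss o t)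
    rw [z1, z1, map_zero, zero_add, zero_add] at this
    exact this
  have q3 : ∀ g h t, c' (ss o t * g) h = repM k ι (ss o t) (c' g h) := by
    intro g h t
    have := cc (ss o t) g h
    rw [z2, z2, add_zero, add_zero] at this
    exact this.symm
  have tw : TW (resA o c') := by
    constructor
    · intro a b d
      have := cc (uu a) (uu b) (uu d)
      simpa only [resA, uu_mul] using this
    · intro t a b
      simp only [resA]
      rw [← q2 _ _ t, ← cj, ← q1, ← cj, q3]
    · intro a
      have := z2 (uu a) 1
      rw [ss_one] at this
      simpa only [resA, uu_zero] using this
    · intro a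
      have := z1 (uu a) 1
      rw [ss_one] at this
      simpa only [resA, uu_zero] using this
  have hF' : ∀ a, FF p (resA o c') a = FF p (resA o c) a := by
    intro a
    have : resA o c' = fun a b => resA o c a b - dU (fun a => b0 (uu a)) a b := by
      ext1 x; ext1 y
      simp only [← resA_dd]; rfl
    rw [this, FF_sub, FF_dU hp5 hp, sub_zero]
  obtain ⟨φ, f1, f2, f3⟩ := A2 hp5 hp tw (fun x l hx hl => by rw [hF']; exact hF x l hx hl)
  refine ⟨fun g => b0 g + φ (aOf o g), ?_⟩
  rintro _ ⟨a, t, rfl⟩ _ ⟨b, t', rfl⟩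
  rw [dd_add]
  have e : c' (uu a * ss o t) (uu b * ss o t') =
      dd (repM k ι) (fun g => φ (aOf o g)) (uu a * ss o t) (uu b * ss o t') := by
    have e1 : uu a * ss o t * (uu b * ss o t') = uu (a + (t : k) • b) * ss o (t * t') := by
      rw [← uu_mul, ← ss_mul, mul_assoc, ← mul_assoc (ss o t), cj]
      simp only [mul_assoc]
    rw [q2, q1, cj, q2, dd, e1, aOf_eq, aOf_eq, aOf_eq]
    have := f3 a ((t : k) • b)
    rw [resA] at this
    rw [this, dU, f1, map_mul, Module.End.mul_apply]
  rw [← e]; simp only [hc']; abel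

lemma H2G (hp5 : 5 ≤ p) (hp : p.Prime) (o : ι) {c : GL ι k → GL ι k → MS k ι} (hc : Coc (repM k ι) c)
    (hF : ∀ x l, x ≠ o → l ≠ o → (FF p (resA o c) (E k o x) : M4 k ι) (o, o) (o, l) = 0) :
    ∃ b, ∀ g h, c g h = dd (repM k ι) b g h := by
  have : Nonempty ι := ⟨o⟩
  obtain ⟨b, hb⟩ := H2N hp5 hp o hc hF
  obtain ⟨b', hb'⟩ := L3 hc (NN k o) (PP k o) (NN_le o) (fun g hg n hn => (hg n).mp hn)
    (H0N' (p := p) hp5 o) (H1N (p := p) hp5 o) b hb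
  exact L2 hc (PP k o) (index_ne o) b' hb'

lemma FF_conj (hp5 : 5 ≤ p) (hp : p.Prime) {o : ι} {c : GL ι k → GL ι k → MS k ι} (hc : Coc (repM k ι) c)
    (g : GL ι k) (a a' : AS k o) (hg : ∀ i : ℕ, g * uu (i • a) = uu (i • a') * g) :
    FF p (resA o c) a' = repM k ι g (FF p (resA o c) a) := by
  let η : ℕ → MS k ι := fun i => c g (uu (i • a)) - c (uu (i • a')) g
  have key : ∀ i : ℕ, repM k ι g (c (uu (i • a)) (uu a)) - c (uu (i • a')) (uu a') =
      repM k ι (uu (i • a')) (η 1) - (η (i + 1) - η i) := by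
    intro i
    have g1 : g * uu a = uu a' * g := by simpa using hg 1
    have e1 := hc g (uu (i • a)) (uu a)
    have e2 := hc (uu (i • a')) g (uu a)
    have e3 := hc (uu (i • a')) (uu a') g
    rw [uu_mul, ← succ_nsmul, hg] at e1
    rw [g1] at e2
    rw [uu_mul, ← succ_nsmul] at e3
    simp only [η, map_sub, one_smul]
    linear_combination (norm := module) e1 - e2 + e3
  have : repM k ι g (FF p (resA o c) a) - FF p (resA o c) a' = 0 := by
    simp only [FF, resA, map_sum]
    rw [← Finset.sum_sub_distrib]
    simp only [key]
    rw [Finset.sum_sub_distrib, norm_zero hp5 hp, Finset.sum_range_sub]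
    simp [η, psmul k a, psmul k a']
  exact (sub_eq_zero.mp this).symm

/-- the detecting functional -/
def Phi (o x : ι) (p : ℕ) (c : GL ι k → GL ι k → MS k ι) : k :=
  (FF p (resA o c) (E k o x) : M4 k ι) (o, o) (o, x)

lemma Phi_dd (hp5 : 5 ≤ p) (hp : p.Prime) (o x : ι) (b : GL ι k → MS k ι) :
    Phi o x p (dd (repM k ι) b) = 0 := by
  rw [Phi, resA_dd, FF_dU hp5 hp]; rfl

lemma H2Phi (hp5 : 5 ≤ p) (hp : p.Prime) {o x0 : ι} (hx0 : x0 ≠ o) {c : GL ι k → GL ι k → MS k ι}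
    (hc : Coc (repM k ι) c) (h : Phi o x0 p c = 0) : ∃ b, ∀ g h, c g h = dd (repM k ι) b g h := by
  have h2 : (2 : k) ≠ 0 := two_ne hp5
  apply H2G hp5 hp o hc
  intro x l hx hl
  by_cases hlx : l = x
  · subst hlx
    have e := FF_conj hp5 hp hc (pm (Equiv.swap x0 l)) (E k o x0) (E k o l) ?_
    · rw [e, pm_act, Equiv.symm_swap, Equiv.swap_apply_of_ne_of_ne hx0.symm hl.symm, Equiv.swap_apply_right]
      exact h
    · intro m
      apply Units.ext
      change (1 : Matrix ι ι k).submatrix (Equiv.swap x0 l).symm id * um o (m • (E k o x0 : ι → k)) =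
        um o (m • (E k o l : ι → k)) * (1 : Matrix ι ι k).submatrix (Equiv.swap x0 l).symm id
      have e : ∀ x y : ι, Equiv.swap x0 l x = y ↔ x = Equiv.swap x0 l y := fun x y => by
        rw [← Equiv.eq_symm_apply, Equiv.symm_swap]
      have e' : ∀ x : ι, Equiv.swap x0 l x = o ↔ x = o := by
        intro x; rw [e, Equiv.swap_apply_of_ne_of_ne hx0.symm hl.symm]
      have e'' : ∀ x : ι, Equiv.swap x0 l x = x0 ↔ x = l := by
        intro x; rw [e, Equiv.swap_apply_left]
      ext i j
      simp only [Matrix.mul_apply, Matrix.submatrix_apply, Equiv.symm_swap, id, Matrix.one_apply, e]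
      simp [um, Matrix.one_apply, e, E_coe hx0, E_coe hl]
      simp only [← e, e', e'']
      rw [Finset.sum_ite_eq]
      simp [e']
  · have e := FF_conj hp5 hp hc (dg fun i => if i = l then Units.mk0 2 h2 else 1) (E k o x) (E k o x) ?_
    · have e1 := dg_act (fun i => if i = l then Units.mk0 2 h2 else 1) (FF p (resA o c) (E k o x)) o o o l
      rw [← e] at e1
      simp [hl.symm] at e1
      have e3 : 2 * (FF p (resA o c) (E k o x) : M4 k ι) (o, o) (o, l) =
        (FF p (resA o c) (E k o x) : M4 k ι) (o, o) (o, l) := by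
        nth_rw 1 [e1]; field_simp
      linear_combination e3
    · intro m
      apply Units.ext
      change Matrix.diagonal _ * um o (m • (E k o x : ι → k)) = um o (m • (E k o x : ι → k)) * Matrix.diagonal _
      ext i j
      rw [Matrix.diagonal_mul, Matrix.mul_diagonal]
      simp only [um, Matrix.add_apply, Matrix.of_apply, Matrix.one_apply, Pi.smul_apply, E_coe hx]
      by_cases hi : i = o
      · subst hi
        by_cases hj : j = x
        · simp [hj, Ne.symm hlx, hl.symm, hx.symm]
        · by_cases hj' : i = j
          · subst hj'; simp [hl.symm, hj]
          · simp [hj, hj']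
      · by_cases hij : i = j
        · subst hij; simp [hi]
        · simp [hi, hij]

end Main
end GLC

namespace GLC
open scoped Kronecker
noncomputable section Witt
variable {k : Type} [Field k] {ι : Type} [Fintype ι] [DecidableEq ι]

/-- swap matrix -/
def tau (k ι : Type) [Field k] [DecidableEq ι] : M4 k ι := (1 : M4 k ι).submatrix Prod.swap id

lemma tau_mul (Y : M4 k ι) : tau k ι * Y = Y.submatrix Prod.swap id := by
  have := Matrix.submatrix_mul_equiv (1 : M4 k ι) Y Prod.swap (Equiv.refl _) id
  simpa [tau] using this

lemma tau_K2 (g : Matrix ι ι k) : tau k ι * K2 g = K2 g * tau k ι := by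
  rw [tau_mul]
  have := Matrix.submatrix_mul_equiv (K2 g) (1 : M4 k ι) id (Equiv.refl _) Prod.swap
  have h3 : tau k ι = (1 : M4 k ι).submatrix id Prod.swap := by
    ext ⟨i, j⟩ ⟨l, r⟩; simp [tau, Matrix.one_apply, and_comm]
  have h2 : (K2 g).submatrix Prod.swap id = (K2 g).submatrix id Prod.swap := by
    ext ⟨i, j⟩ ⟨l, r⟩; simp [K2, mul_comm]
  rw [h2, h3]
  simpa using this.symm

/-- `gl → Hom(Λ², S²)` -/
def JM (A : Matrix ι ι k) : M4 k ι := (1 + tau k ι) * (A ⊗ₖ 1 - 1 ⊗ₖ A)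

lemma JM_apply (A : Matrix ι ι k) (i j l r : ι) : JM A (i, j) (l, r) =
    (A i l * (1 : Matrix ι ι k) j r - (1 : Matrix ι ι k) i l * A j r) +
    (A j l * (1 : Matrix ι ι k) i r - (1 : Matrix ι ι k) j l * A i r) := by
  rw [JM, add_mul, one_mul, tau_mul]
  rfl

/-- linear map into `MS` -/
def JJ : Matrix ι ι k →ₗ[k] MS k ι where
  toFun A := ⟨JM A, MS.mk (fun i j l r => by simp only [JM_apply]; ring)
    (fun i j l r => by simp only [JM_apply]; ring)⟩
  map_add' A B := by
    apply Subtype.ext; ext ⟨i, j⟩ ⟨l, r⟩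
    change JM _ _ _ = JM A _ _ + JM B _ _
    simp only [JM_apply, Matrix.add_apply]; ring
  map_smul' a A := by
    apply Subtype.ext; ext ⟨i, j⟩ ⟨l, r⟩
    change JM _ _ _ = a * JM A _ _
    simp only [JM_apply, Matrix.smul_apply, smul_eq_mul]; ring

lemma JJ_act (g : GL ι k) (A : Matrix ι ι k) : repM k ι g (JJ A) =
    JJ ((g : Matrix ι ι k) * A * (↑g⁻¹ : Matrix ι ι k)) := by
  apply Subtype.ext
  rw [repM_coe]
  change K2 _ * JM _ * _ = JM _
  have h1 : (g : Matrix ι ι k) * (↑g⁻¹ : Matrix ι ι k) = 1 := by simp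
  have e : (1 + tau k ι) * K2 (g : Matrix ι ι k) = K2 (g : Matrix ι ι k) * (1 + tau k ι) := by
    rw [add_mul, mul_add, tau_K2, one_mul, mul_one]
  rw [JM, JM, ← mul_assoc, ← e, mul_assoc, mul_assoc]
  congr 1
  rw [sub_mul, mul_sub]
  simp only [K2, ← Matrix.mul_kronecker_mul, mul_one, one_mul, h1, mul_assoc]

variable {p : ℕ} [CharP k p] [Fintype k] [Fact p.Prime]

/-- Teichmueller lift -/
def SW (p : ℕ) [Fact p.Prime] (g : GL ι k) : Matrix ι ι (WittVector p k) :=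
  (g : Matrix ι ι k).map (WittVector.teichmuller p)

lemma cc_teich (a : k) : WittVector.constantCoeff (WittVector.teichmuller p a) = a :=
  WittVector.teichmuller_coeff_zero p a

lemma SW_red (g : GL ι k) : (SW p g).map WittVector.constantCoeff = (g : Matrix ι ι k) := by
  ext i j; simp only [SW, Matrix.map_apply, cc_teich]

lemma gam_ex (g h : GL ι k) : ∃ Γ : Matrix ι ι (WittVector p k),
    SW p g * SW p h = SW p (g * h) + (p : WittVector p k) • Γ := by
  have : ∀ i j, ∃ w : WittVector p k, (SW p g * SW p h) i j - SW p (g * h) i j = p * w := by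
    intro i j
    have e : (SW p g * SW p h) i j - SW p (g * h) i j ∈
        RingHom.ker (WittVector.constantCoeff : WittVector p k →+* k) := by
      rw [RingHom.mem_ker, map_sub]
      have h1 : WittVector.constantCoeff ((SW p g * SW p h) i j) =
          (((SW p g).map WittVector.constantCoeff) * ((SW p h).map WittVector.constantCoeff)) i j := by
        rw [← Matrix.map_mul]; rfl
      have h2 : WittVector.constantCoeff (SW p (g * h) i j) =
          ((SW p (g * h)).map WittVector.constantCoeff) i j := rfl
      rw [h1, h2, SW_red, SW_red, SW_red]; simp
    rw [WittVector.ker_constantCoeff, Ideal.mem_span_singleton] at e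
    exact e
  choose w hw using this
  refine ⟨Matrix.of w, ?_⟩
  ext1 i j
  have := hw i j
  simp only [Matrix.add_apply, Matrix.smul_apply, Matrix.of_apply, smul_eq_mul]
  linear_combination this

/-- lifted cochain -/
def GT (p : ℕ) [Fact p.Prime] [CharP k p] (g h : GL ι k) : Matrix ι ι (WittVector p k) :=
  (gam_ex (p := p) g h).choose

lemma GT_spec (g h : GL ι k) : SW p g * SW p h = SW p (g * h) + (p : WittVector p k) • GT p g h :=
  (gam_ex (p := p) g h).choose_spec

/-- reduction -/
def gm (p : ℕ) [Fact p.Prime] [CharP k p] (g h : GL ι k) : Matrix ι ι k :=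
  (GT p g h).map WittVector.constantCoeff

lemma GT_coc (g h x : GL ι k) : GT p g (h * x) + SW p g * GT p h x = GT p (g * h) x + GT p g h * SW p x := by
  have hp : (p : WittVector p k) ≠ 0 := WittVector.p_nonzero p k
  have e : (p : WittVector p k) • (GT p g (h * x) + SW p g * GT p h x) =
      (p : WittVector p k) • (GT p (g * h) x + GT p g h * SW p x) := by
    have e1 : SW p g * (SW p h * SW p x) = (SW p g * SW p h) * SW p x := (mul_assoc _ _ _).symm
    rw [GT_spec h x, GT_spec g h, mul_add, add_mul, GT_spec, GT_spec, mul_assoc g h x] at e1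
    rw [Matrix.mul_smul, Matrix.smul_mul, add_assoc, add_assoc] at e1
    rw [smul_add, smul_add]
    exact add_left_cancel e1
  ext1 i j
  have := congrFun (congrFun e i) j
  simp only [Matrix.smul_apply, smul_eq_mul] at this
  exact mul_left_cancel₀ hp this

lemma gm_coc (g h x : GL ι k) : gm p g (h * x) + (g : Matrix ι ι k) * gm p h x =
    gm p (g * h) x + gm p g h * (x : Matrix ι ι k) := by
  have := congrArg (fun M => M.map (WittVector.constantCoeff : WittVector p k →+* k)) (GT_coc (p := p) g h x)
  simp only [Matrix.map_add _ (map_add (WittVector.constantCoeff : WittVector p k →+* k)),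
    Matrix.map_mul, SW_red] at this
  exact this

/-- cocycle -/
def cM (p : ℕ) [Fact p.Prime] [CharP k p] (g h : GL ι k) : MS k ι :=
  JJ (gm p g h * (↑(g * h)⁻¹ : Matrix ι ι k))

lemma cM_coc : Coc (repM k ι) (cM (k := k) (ι := ι) p) := by
  intro g h x
  simp only [cM]
  rw [JJ_act, ← map_add, ← map_add]
  congr 1
  have hx : (x : Matrix ι ι k) * (↑x⁻¹ : Matrix ι ι k) = 1 := by simp
  have e1 : (↑(g * h)⁻¹ : Matrix ι ι k) = (x : Matrix ι ι k) * (↑(g * h * x)⁻¹ : Matrix ι ι k) := by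
    rw [← Units.val_mul]; congr 1; group
  have e2 : (↑(h * x)⁻¹ : Matrix ι ι k) * (↑g⁻¹ : Matrix ι ι k) = (↑(g * h * x)⁻¹ : Matrix ι ι k) := by
    rw [← Units.val_mul]; congr 1; group
  rw [e1, ← mul_assoc g h x, mul_assoc (g : Matrix ι ι k), mul_assoc (gm p h x), e2, ← mul_assoc, ← mul_assoc,
    ← add_mul, ← add_mul, add_comm ((g : Matrix ι ι k) * _), gm_coc]

lemma SW_uu {o x : ι} (hx : x ≠ o) (m : ℕ) (i j : ι) : SW p (uu (m • E k o x)) i j =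
    if i = j then 1 else if i = o ∧ j = x then WittVector.teichmuller p (m : k) else 0 := by
  have : (uu (m • E k o x) : Matrix ι ι k) i j = if i = j then 1 else if i = o ∧ j = x then (m : k) else 0 := by
    change um o (m • (E k o x : ι → k)) i j = _
    simp only [um, Matrix.add_apply, Matrix.of_apply, Matrix.one_apply, Pi.smul_apply, E_coe hx]
    by_cases hij : i = j
    · subst hij
      by_cases hi : i = o
      · subst hi; simp [hx.symm]
      · simp [hi]
    · by_cases hi : i = o <;> by_cases hj : j = x <;> simp [hij, hi, hj, hx.symm]
  change WittVector.teichmuller p ((uu (m • E k o x) : Matrix ι ι k) i j) = _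
  rw [this]
  split_ifs <;> simp

lemma GT_row {o x : ι} (hx : x ≠ o) (m : ℕ) (y : ι) :
    (SW p (uu (m • E k o x)) * SW p (uu (E k o x))) o y =
      SW p (uu (E k o x)) o y + WittVector.teichmuller p (m : k) * SW p (uu (E k o x)) x y := by
  rw [Matrix.mul_apply, Finset.sum_eq_add o x hx.symm]
  · simp [SW_uu hx, hx.symm]
  · intro z _ hz
    simp [SW_uu hx, Ne.symm hz.1, hz.2]
  · simp
  · simp

lemma GT_oo {o x : ι} (hx : x ≠ o) (m : ℕ) : GT p (uu (m • E k o x)) (uu (E k o x)) o o = 0 := by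
  have e := congrFun (congrFun (GT_spec (p := p) (uu (m • E k o x)) (uu (E k o x))) o) o
  rw [GT_row hx, uu_mul, ← succ_nsmul] at e
  have h1 := SW_uu (p := p) hx 1 (k := k)
  rw [one_smul] at h1
  simp only [Matrix.add_apply, Matrix.smul_apply, h1, SW_uu hx, smul_eq_mul] at e
  simpa [hx, WittVector.p_nonzero p k] using e

lemma GT_ox {o x : ι} (hx : x ≠ o) (m : ℕ) : (p : WittVector p k) * GT p (uu (m • E k o x)) (uu (E k o x)) o x =
    1 - (WittVector.teichmuller p ((m + 1 : ℕ) : k) - WittVector.teichmuller p (m : k)) := by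
  have e := congrFun (congrFun (GT_spec (p := p) (uu (m • E k o x)) (uu (E k o x))) o) x
  rw [GT_row hx, uu_mul, ← succ_nsmul] at e
  have h1 := SW_uu (p := p) hx 1 (k := k)
  rw [one_smul] at h1
  simp only [Matrix.add_apply, Matrix.smul_apply, h1, SW_uu hx, smul_eq_mul] at e
  simp only [if_neg hx.symm, Nat.cast_one, map_one, and_self, if_true, mul_one] at e
  linear_combination -e

lemma GT_sum {o x : ι} (hx : x ≠ o) :
    ∑ m ∈ Finset.range p, GT p (uu (m • E k o x)) (uu (E k o x)) o x = 1 := by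
  have hp : (p : WittVector p k) ≠ 0 := WittVector.p_nonzero p k
  apply mul_left_cancel₀ hp
  rw [Finset.mul_sum]
  simp only [GT_ox hx]
  rw [Finset.sum_sub_distrib, Finset.sum_range_sub (fun m => WittVector.teichmuller p (m : k))]
  simp

lemma cM_ox {o x : ι} (hx : x ≠ o) (m : ℕ) :
    (cM p (uu (m • E k o x)) (uu (E k o x)) : M4 k ι) (o, o) (o, x) =
      -2 * WittVector.constantCoeff (GT p (uu (m • E k o x)) (uu (E k o x)) o x) := by
  change JM _ _ _ = _
  rw [JM_apply]
  have e : (gm p (uu (m • E k o x)) (uu (E k o x)) *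
      (↑(uu (m • E k o x) * uu (E k o x))⁻¹ : Matrix ι ι k)) o x =
      WittVector.constantCoeff (GT p (uu (m • E k o x)) (uu (E k o x)) o x) := by
    rw [uu_mul]
    change ((gm p (uu (m • E k o x)) (uu (E k o x)) : Matrix ι ι k) *
      um o (-((m • E k o x + E k o x : AS k o) : ι → k))) o x = _
    rw [Matrix.mul_apply]
    simp only [um, Matrix.add_apply, Matrix.of_apply, mul_add, Finset.sum_add_distrib]
    rw [← Matrix.mul_apply, mul_one]
    have : gm p (uu (m • E k o x)) (uu (E k o x)) o o = 0 := by
      simp only [gm, Matrix.map_apply, GT_oo hx, map_zero]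
    simp only [mul_ite, mul_zero, Finset.sum_ite_eq', Finset.mem_univ, if_true, this, zero_mul, add_zero]
    rfl
  rw [e]
  simp [hx.symm]
  ring

lemma Phi_cM {o x : ι} (hx : x ≠ o) : Phi o x p (cM (k := k) (ι := ι) p) = -2 := by
  rw [Phi, FF, AddSubmonoidClass.coe_finsetSum, Matrix.sum_apply]
  simp only [resA, cM_ox hx]
  rw [← Finset.mul_sum, ← map_sum, GT_sum hx]
  simp

end Witt
end GLC

namespace GLC
open scoped Kronecker TensorProduct
noncomputable section Alt
variable {k : Type} [Field k] {ι : Type} [Fintype ι] [DecidableEq ι]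

/-- antisymmetrised Kronecker product -/
def KA (x y : Matrix ι ι k) : M4 k ι := x ⊗ₖ y - y ⊗ₖ x

lemma KA_apply (x y : Matrix ι ι k) (i j l r : ι) :
    KA x y (i, j) (l, r) = x i l * y j r - y i l * x j r := rfl

/-- as a multilinear map -/
def KML (k ι : Type) [Field k] [Fintype ι] [DecidableEq ι] :
    MultilinearMap k (fun _ : Fin 2 => Matrix ι ι k) (M4 k ι) where
  toFun f := KA (f 0) (f 1)
  map_update_add' f i x y := by
    ext ⟨a, b⟩ ⟨c, d⟩
    rw [Matrix.add_apply]
    fin_cases i <;> simp [KA_apply] <;> ring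
  map_update_smul' f i a x := by
    ext ⟨i', b⟩ ⟨c, d⟩
    rw [Matrix.smul_apply]
    fin_cases i <;> simp [KA_apply] <;> ring

/-- `Λ² gl` -/
abbrev TT (k ι : Type) [Field k] [Fintype ι] [DecidableEq ι] := AltPow k (Matrix ι ι k) 2

/-- wedge -/
def wd (x y : Matrix ι ι k) : TT k ι := Submodule.Quotient.mk (PiTensorProduct.tprod k ![x, y])

lemma wd_self (x : Matrix ι ι k) : wd x x = 0 := by
  rw [wd, Submodule.Quotient.mk_eq_zero]
  exact Submodule.subset_span ⟨_, 0, 1, by decide, rfl, rfl⟩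

lemma wd_add_left (x y z : Matrix ι ι k) : wd (x + y) z = wd x z + wd y z := by
  have := (PiTensorProduct.tprod k (s := fun _ : Fin 2 => Matrix ι ι k)).cons_add ![z] x y
  rw [wd, wd, wd, ← Submodule.Quotient.mk_add]
  exact congrArg _ this

lemma wd_smul_left (a : k) (x z : Matrix ι ι k) : wd (a • x) z = a • wd x z := by
  have := (PiTensorProduct.tprod k (s := fun _ : Fin 2 => Matrix ι ι k)).cons_smul ![z] a x
  rw [wd, wd, ← Submodule.Quotient.mk_smul]
  exact congrArg _ this

lemma wd_add_right (x y z : Matrix ι ι k) : wd z (x + y) = wd z x + wd z y := by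
  have := (PiTensorProduct.tprod k (s := fun _ : Fin 2 => Matrix ι ι k)).map_update_add ![z, 0] 1 x y
  rw [wd, wd, wd, ← Submodule.Quotient.mk_add]
  refine congrArg _ ?_
  have e : ∀ w : Matrix ι ι k, Function.update (![z, 0] : Fin 2 → Matrix ι ι k) 1 w = ![z, w] := by
    intro w
    funext i
    fin_cases i <;> rfl
  rw [e, e] at this
  try rw [e] at this
  exact this

lemma wd_smul_right (a : k) (x z : Matrix ι ι k) : wd z (a • x) = a • wd z x := by
  have := (PiTensorProduct.tprod k (s := fun _ : Fin 2 => Matrix ι ι k)).map_update_smul ![z, 0] 1 a x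
  rw [wd, wd, ← Submodule.Quotient.mk_smul]
  refine congrArg _ ?_
  have e : ∀ w : Matrix ι ι k, Function.update (![z, 0] : Fin 2 → Matrix ι ι k) 1 w = ![z, w] := by
    intro w
    funext i
    fin_cases i <;> rfl
  rw [e, e] at this
  try rw [e] at this
  exact this

/-- bilinear wedge -/
def wl (k ι : Type) [Field k] [Fintype ι] [DecidableEq ι] : Matrix ι ι k →ₗ[k] Matrix ι ι k →ₗ[k] TT k ι :=
  LinearMap.mk₂ k wd wd_add_left wd_smul_left (fun z x y => wd_add_right x y z) (fun a z x => wd_smul_right a x z)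

lemma wl_apply (x y : Matrix ι ι k) : wl k ι x y = wd x y := rfl

lemma wd_swap (x y : Matrix ι ι k) : wd y x = - wd x y := by
  have := wd_self (x + y)
  rw [wd_add_left, wd_add_right, wd_add_right, wd_self, wd_self] at this
  rw [eq_neg_iff_add_eq_zero]
  simpa [add_comm] using this

lemma TT_ext {M : Type} [AddCommGroup M] [Module k M] {f g : TT k ι →ₗ[k] M} (h : ∀ x y, f (wd x y) = g (wd x y)) :
    f = g := by
  refine Submodule.linearMap_qext _ (PiTensorProduct.ext ?_)
  apply MultilinearMap.ext
  intro v
  have e : v = ![v 0, v 1] := by funext i; fin_cases i <;> rfl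
  have := h (v 0) (v 1)
  rw [wd, ← e] at this
  exact this

/-- descended map -/
def KL (k ι : Type) [Field k] [Fintype ι] [DecidableEq ι] : TT k ι →ₗ[k] M4 k ι :=
  Submodule.liftQ _ (PiTensorProduct.lift (KML k ι)) (by
    rw [altPowSub, Submodule.span_le]
    rintro z ⟨f, i, j, hij, hf, rfl⟩
    have h01 : f 0 = f 1 := by
      fin_cases i <;> fin_cases j <;> simp_all
    rw [SetLike.mem_coe, LinearMap.mem_ker, PiTensorProduct.lift.tprod]
    change KA (f 0) (f 1) = 0
    rw [h01, KA, sub_self])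

lemma KL_wd (x y : Matrix ι ι k) : KL k ι (wd x y) = KA x y := by
  change PiTensorProduct.lift (KML k ι) (PiTensorProduct.tprod k ![x, y]) = _
  rw [PiTensorProduct.lift.tprod]; rfl

/-- the other way -/
def RL (k ι : Type) [Field k] [Fintype ι] [DecidableEq ι] : M4 k ι →ₗ[k] TT k ι where
  toFun X := ∑ i, ∑ l, ∑ j, ∑ r, X (i, j) (l, r) • wd (Matrix.single i l 1) (Matrix.single j r 1)
  map_add' X Y := by simp only [Matrix.add_apply, add_smul, Finset.sum_add_distrib]
  map_smul' a X := by simp only [Matrix.smul_apply, smul_eq_mul, mul_smul, Finset.smul_sum, RingHom.id_apply]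

lemma RL_apply (X : M4 k ι) : RL k ι X =
  ∑ i, ∑ l, ∑ j, ∑ r, X (i, j) (l, r) • wd (Matrix.single i l 1) (Matrix.single j r 1) := rfl

lemma RL_kron (x y : Matrix ι ι k) : RL k ι (x ⊗ₖ y) = wd x y := by
  have e : ∀ z : Matrix ι ι k, z = ∑ i, ∑ l, z i l • Matrix.single i l (1 : k) := by
    intro z
    conv_lhs => rw [Matrix.matrix_eq_sum_single z]
    simp only [Matrix.smul_single, smul_eq_mul, mul_one]
  conv_rhs => rw [← wl_apply, e x]
  simp only [map_sum, map_smul, LinearMap.sum_apply, LinearMap.smul_apply]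
  rw [RL_apply]
  refine Finset.sum_congr rfl fun i _ => Finset.sum_congr rfl fun l _ => ?_
  conv_rhs => rw [e y]
  simp only [map_sum, map_smul, Finset.smul_sum, smul_smul, wl_apply]
  refine Finset.sum_congr rfl fun j _ => Finset.sum_congr rfl fun r _ => ?_
  simp only [Matrix.kroneckerMap_apply]

lemma RL_KL (t : TT k ι) : RL k ι (KL k ι t) = (2 : k) • t := by
  have : RL k ι ∘ₗ KL k ι = (2 : k) • LinearMap.id := by
    apply TT_ext
    intro x y
    rw [LinearMap.comp_apply, KL_wd, KA, map_sub, RL_kron, RL_kron, wd_swap x y, LinearMap.smul_apply,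
      LinearMap.id_apply, two_smul, sub_neg_eq_add]
  exact LinearMap.congr_fun this t

lemma KL_anti (t : TT k ι) (i j l r : ι) : KL k ι t (j, i) (r, l) = - KL k ι t (i, j) (l, r) := by
  have : LinearMap.comp (⟨⟨fun X : M4 k ι => X (j, i) (r, l), fun _ _ => rfl⟩, fun _ _ => rfl⟩ : M4 k ι →ₗ[k] k) (KL k ι) =
      LinearMap.comp (⟨⟨fun X : M4 k ι => - X (i, j) (l, r), fun _ _ => by rw [Matrix.add_apply]; ring⟩,
        fun _ _ => by simp⟩ : M4 k ι →ₗ[k] k) (KL k ι) := by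
    apply TT_ext
    intro x y
    rw [LinearMap.comp_apply, LinearMap.comp_apply, KL_wd]
    change KA x y _ _ = - KA x y _ _
    rw [KA_apply, KA_apply]; ring
  exact LinearMap.congr_fun this t

lemma KL_RL (X : M4 k ι) (i j l r : ι) : KL k ι (RL k ι X) (i, j) (l, r) = X (i, j) (l, r) - X (j, i) (r, l) := by
  rw [RL_apply]
  simp only [map_sum, map_smul, KL_wd, Matrix.sum_apply, Matrix.smul_apply, KA_apply, smul_eq_mul, mul_sub,
    Finset.sum_sub_distrib]
  congr 1
  · rw [Finset.sum_eq_single i, Finset.sum_eq_single l, Finset.sum_eq_single j, Finset.sum_eq_single r]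
    all_goals try simp
    all_goals (intros; simp_all [Matrix.single_apply])
  · rw [Finset.sum_eq_single j, Finset.sum_eq_single r, Finset.sum_eq_single i, Finset.sum_eq_single l]
    all_goals try simp
    all_goals (intros; simp_all [Matrix.single_apply])

/-- first projection -/
def Q1M (X : M4 k ι) : M4 k ι := (1 + tau k ι) * X
/-- second projection -/
def Q2M (X : M4 k ι) : M4 k ι := ((1 - tau k ι) * X).transpose

lemma Q1M_apply (X : M4 k ι) (i j l r : ι) : Q1M X (i, j) (l, r) = X (i, j) (l, r) + X (j, i) (l, r) := by
  rw [Q1M, add_mul, one_mul, tau_mul]; rfl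

lemma Q2M_apply (X : M4 k ι) (i j l r : ι) : Q2M X (i, j) (l, r) = X (l, r) (i, j) - X (r, l) (i, j) := by
  rw [Q2M, sub_mul, one_mul, tau_mul]; rfl

/-- backward map -/
def ZM (X Y : M4 k ι) : M4 k ι := X + Y.transpose

/-- the decomposition -/
def eT (h2 : (2 : k) ≠ 0) : TT k ι ≃ₗ[k] MS k ι × MS k ι where
  toFun t := (⟨Q1M (KL k ι t), MS.mk (fun i j l r => by simp only [Q1M_apply]; ring)
      (fun i j l r => by
        simp only [Q1M_apply]; rw [KL_anti t i j l r, ← neg_neg (KL k ι t (i, j) (r, l)), ← KL_anti t i j r l]; ring)⟩,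
    ⟨Q2M (KL k ι t), MS.mk (fun i j l r => by
        simp only [Q2M_apply]; rw [KL_anti t l r i j, ← neg_neg (KL k ι t (l, r) (j, i)), ← KL_anti t l r j i]; ring)
      (fun i j l r => by simp only [Q2M_apply]; ring)⟩)
  map_add' t s := by
    refine Prod.ext (Subtype.ext ?_) (Subtype.ext ?_)
    · simp [Q1M, mul_add]
    · simp [Q2M, mul_add]
  map_smul' t s := by
    refine Prod.ext (Subtype.ext ?_) (Subtype.ext ?_)
    · simp [Q1M]
    · simp [Q2M]
  invFun q := (4 : k)⁻¹ • RL k ι (ZM (q.1 : M4 k ι) (q.2 : M4 k ι))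
  left_inv t := by
    have h4 : (4 : k) ≠ 0 := by
      have : (4 : k) = 2 * 2 := by norm_num
      rw [this]; exact mul_ne_zero h2 h2
    have : ZM (Q1M (KL k ι t)) (Q2M (KL k ι t)) = (2 : k) • KL k ι t := by
      ext ⟨i, j⟩ ⟨l, r⟩
      rw [ZM, Matrix.add_apply, Matrix.transpose_apply, Q1M_apply, Q2M_apply, Matrix.smul_apply, smul_eq_mul]
      ring
    change (4 : k)⁻¹ • RL k ι (ZM (Q1M (KL k ι t)) (Q2M (KL k ι t))) = t
    rw [this, map_smul, RL_KL, smul_smul, smul_smul, mul_assoc]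
    have : (4 : k)⁻¹ * (2 * 2) = 1 := by field_simp; norm_num
    rw [this, one_smul]
  right_inv q := by
    obtain ⟨⟨X, hX⟩, ⟨Y, hY⟩⟩ := q
    have h4 : (4 : k) ≠ 0 := by
      have : (4 : k) = 2 * 2 := by norm_num
      rw [this]; exact mul_ne_zero h2 h2
    have e : ∀ i j l r, KL k ι ((4 : k)⁻¹ • RL k ι (ZM X Y)) (i, j) (l, r) =
        (2 : k)⁻¹ * (X (i, j) (l, r) + Y (l, r) (i, j)) := by
      intro i j l r
      rw [map_smul, Matrix.smul_apply, KL_RL]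
      simp only [ZM, Matrix.add_apply, Matrix.transpose_apply, smul_eq_mul]
      rw [MS.sym hX i j, MS.alt hX l r, MS.sym hY l r, MS.alt hY i j]
      field_simp
      ring
    refine Prod.ext (Subtype.ext ?_) (Subtype.ext ?_)
    · ext ⟨i, j⟩ ⟨l, r⟩
      change Q1M _ _ _ = X _ _
      rw [Q1M_apply, e, e, MS.sym hX i j, MS.alt hY i j]
      field_simp
      ring
    · ext ⟨i, j⟩ ⟨l, r⟩
      change Q2M _ _ _ = Y _ _
      rw [Q2M_apply, e, e, MS.sym hX l r, MS.alt hY l r]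
      field_simp
      ring

lemma eT_fst (h2 : (2 : k) ≠ 0) (t : TT k ι) : ((eT h2 t).1 : M4 k ι) = Q1M (KL k ι t) := rfl
lemma eT_snd (h2 : (2 : k) ≠ 0) (t : TT k ι) : ((eT h2 t).2 : M4 k ι) = Q2M (KL k ι t) := rfl

/-- inverse transpose -/
def sg : GL ι k →* GL ι k where
  toFun g := ⟨(↑g⁻¹ : Matrix ι ι k).transpose, (g : Matrix ι ι k).transpose,
    by rw [← Matrix.transpose_mul]; simp, by rw [← Matrix.transpose_mul]; simp⟩
  map_one' := by apply Units.ext; simp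
  map_mul' g h := by apply Units.ext; simp [Matrix.transpose_mul]

lemma sg_sg (g : GL ι k) : sg (sg g) = g := by
  apply Units.ext
  rfl

/-- compatibility of a representation -/
def Cpt (ρ : Representation k (GL ι k) (TT k ι)) : Prop :=
  ∀ g x y, ρ g (wd x y) = wd ((g : Matrix ι ι k) * x * (↑g⁻¹ : Matrix ι ι k)) ((g : Matrix ι ι k) * y * (↑g⁻¹ : Matrix ι ι k))

lemma KL_act {ρ : Representation k (GL ι k) (TT k ι)} (h : Cpt ρ) (g : GL ι k) (t : TT k ι) :
    KL k ι (ρ g t) = K2 (g : Matrix ι ι k) * KL k ι t * K2 (↑g⁻¹ : Matrix ι ι k) := by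
  have : KL k ι ∘ₗ ρ g = rep4 g ∘ₗ KL k ι := by
    apply TT_ext
    intro x y
    rw [LinearMap.comp_apply, LinearMap.comp_apply, h, KL_wd, KL_wd]
    change _ = K2 (g : Matrix ι ι k) * KA x y * K2 (↑g⁻¹ : Matrix ι ι k)
    simp only [KA, K2, Matrix.mul_kronecker_mul, mul_sub, sub_mul]
  exact LinearMap.congr_fun this t

lemma eT_act1 {ρ : Representation k (GL ι k) (TT k ι)} (h : Cpt ρ) (h2 : (2 : k) ≠ 0) (g : GL ι k) (t : TT k ι) :
    (eT h2 (ρ g t)).1 = repM k ι g (eT h2 t).1 := by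
  apply Subtype.ext
  rw [repM_coe, eT_fst, eT_fst, KL_act h, Q1M, Q1M]
  have e : (1 + tau k ι) * K2 (g : Matrix ι ι k) = K2 (g : Matrix ι ι k) * (1 + tau k ι) := by
    rw [add_mul, mul_add, tau_K2, one_mul, mul_one]
  simp only [← mul_assoc, e]

lemma eT_act2 {ρ : Representation k (GL ι k) (TT k ι)} (h : Cpt ρ) (h2 : (2 : k) ≠ 0) (g : GL ι k) (t : TT k ι) :
    (eT h2 (ρ g t)).2 = repM k ι (sg g) (eT h2 t).2 := by
  apply Subtype.ext
  rw [repM_coe, eT_snd, eT_snd, KL_act h, Q2M, Q2M]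
  have e : (1 - tau k ι) * K2 (g : Matrix ι ι k) = K2 (g : Matrix ι ι k) * (1 - tau k ι) := by
    rw [sub_mul, mul_sub, tau_K2, one_mul, mul_one]
  have e1 : K2 ((sg g : GL ι k) : Matrix ι ι k) = (K2 (↑g⁻¹ : Matrix ι ι k)).transpose := rfl
  have e2 : K2 (↑(sg g)⁻¹ : Matrix ι ι k) = (K2 (g : Matrix ι ι k)).transpose := rfl
  rw [e1, e2, ← Matrix.transpose_mul, ← Matrix.transpose_mul]
  simp only [← mul_assoc, e]

end Alt
end GLC

namespace GLC
noncomputable section Fin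
open groupCohomology
variable {k : Type} [Field k] {ι : Type} [Fintype ι] [DecidableEq ι]
variable {p : ℕ}

lemma Phi_add (o x : ι) (c c' : GL ι k → GL ι k → MS k ι) :
    Phi o x p (fun g h => c g h + c' g h) = Phi o x p c + Phi o x p c' := by
  simp only [Phi, FF, resA, Finset.sum_add_distrib, Submodule.coe_add, Matrix.add_apply]

lemma Phi_smul (o x : ι) (a : k) (c : GL ι k → GL ι k → MS k ι) :
    Phi o x p (fun g h => a • c g h) = a * Phi o x p c := by
  simp only [Phi, FF, resA, ← Finset.smul_sum, Submodule.coe_smul, Matrix.smul_apply, smul_eq_mul]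

variable {ρ : Representation k (GL ι k) (TT k ι)}

variable [CharP k p] [Fintype k] [DecidableEq k]

lemma fin0 (hρ : Cpt ρ) (hp5 : 5 ≤ p) (o : ι) (t : TT k ι) (ht : ∀ g, ρ g t = t) : t = 0 := by
  have h2 : (2 : k) ≠ 0 := two_ne hp5
  apply (eT h2).injective
  rw [map_zero]
  refine Prod.ext ?_ ?_
  · apply H0N' (p := p) hp5 o
    intro g _
    rw [← eT_act1 hρ, ht]
  · apply H0N' (p := p) hp5 o
    intro g _
    have := eT_act2 hρ h2 (sg g) t
    rw [sg_sg, ht] at this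
    exact this.symm

lemma fin1 (hρ : Cpt ρ) (hp5 : 5 ≤ p) (o : ι) (f : GL ι k → TT k ι)
    (hf : ∀ g h, f (g * h) = ρ g (f h) + f g) : ∃ t, ∀ g, ρ g t - t = f g := by
  have h2 : (2 : k) ≠ 0 := two_ne hp5
  obtain ⟨m1, e1⟩ := H1G (p := p) hp5 o (fun g => (eT h2 (f g)).1) (fun g h => by
    rw [hf, map_add, Prod.fst_add, eT_act1 hρ, add_comm])
  obtain ⟨m2, e2⟩ := H1G (p := p) hp5 o (fun g => (eT h2 (f (sg g))).2) (fun g h => by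
    rw [map_mul, hf, map_add, Prod.snd_add, eT_act2 hρ, sg_sg, add_comm])
  refine ⟨(eT h2).symm (m1, m2), fun g => ?_⟩
  apply (eT h2).injective
  rw [map_sub]
  refine Prod.ext ?_ ?_
  · rw [Prod.fst_sub, eT_act1 hρ, LinearEquiv.apply_symm_apply]
    exact (e1 g).symm
  · rw [Prod.snd_sub, eT_act2 hρ, LinearEquiv.apply_symm_apply]
    have := e2 (sg g)
    simp only [sg_sg] at this
    exact this.symm

/-- first component -/
def C1 (h2 : (2 : k) ≠ 0) (c : GL ι k × GL ι k → TT k ι) (g h : GL ι k) : MS k ι := (eT h2 (c (g, h))).1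
/-- second component -/
def C2 (h2 : (2 : k) ≠ 0) (c : GL ι k × GL ι k → TT k ι) (g h : GL ι k) : MS k ι :=
  (eT h2 (c (sg g, sg h))).2

/-- detecting map -/
def Psi (p : ℕ) (h2 : (2 : k) ≠ 0) (o x : ι) : (GL ι k × GL ι k → TT k ι) →ₗ[k] k × k where
  toFun c := (Phi o x p (C1 h2 c), Phi o x p (C2 h2 c))
  map_add' c c' := by
    refine Prod.ext ?_ ?_
    · rw [Prod.fst_add, ← Phi_add]
      refine congrArg (Phi o x p) ?_; funext g h; simp only [C1, Pi.add_apply, map_add, Prod.fst_add]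
    · rw [Prod.snd_add, ← Phi_add]
      refine congrArg (Phi o x p) ?_; funext g h; simp only [C2, Pi.add_apply, map_add, Prod.snd_add]
  map_smul' a c := by
    refine Prod.ext ?_ ?_
    · rw [RingHom.id_apply, Prod.smul_fst, smul_eq_mul, ← Phi_smul]
      refine congrArg (Phi o x p) ?_; funext g h; simp only [C1, Pi.smul_apply, map_smul, Prod.smul_fst]
    · rw [RingHom.id_apply, Prod.smul_snd, smul_eq_mul, ← Phi_smul]
      refine congrArg (Phi o x p) ?_; funext g h; simp only [C2, Pi.smul_apply, map_smul, Prod.smul_snd]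

/-- cocycle condition -/
def CT (ρ : Representation k (GL ι k) (TT k ι)) (c : GL ι k × GL ι k → TT k ι) : Prop :=
  ∀ g h j, c (g * h, j) + c (g, h) = ρ g (c (h, j)) + c (g, h * j)

lemma CT.c1 (hρ : Cpt ρ) (h2 : (2 : k) ≠ 0) {c : GL ι k × GL ι k → TT k ι} (hc : CT ρ c) :
    Coc (repM k ι) (C1 h2 c) := by
  intro g h x
  simp only [C1]
  rw [← eT_act1 hρ, ← Prod.fst_add, ← Prod.fst_add, ← map_add, ← map_add, hc]

lemma CT.c2 (hρ : Cpt ρ) (h2 : (2 : k) ≠ 0) {c : GL ι k × GL ι k → TT k ι} (hc : CT ρ c) :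
    Coc (repM k ι) (C2 h2 c) := by
  intro g h x
  simp only [C2]
  have e := eT_act2 hρ h2 (sg g) (c (sg h, sg x))
  rw [sg_sg] at e
  rw [← e, ← Prod.snd_add, ← Prod.snd_add, ← map_add, ← map_add, map_mul, map_mul, hc]

lemma Psi_cob (hρ : Cpt ρ) (hp5 : 5 ≤ p) (hp : p.Prime) (h2 : (2 : k) ≠ 0) (o x : ι) (b : GL ι k → TT k ι) :
    Psi p h2 o x (fun q => ρ q.1 (b q.2) - b (q.1 * q.2) + b q.1) = 0 := by
  refine Prod.ext ?_ ?_
  · refine Eq.trans ?_ (Phi_dd (k := k) hp5 hp o x (fun g => (eT h2 (b g)).1))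
    change Phi _ _ _ _ = _
    congr 1; funext g h
    simp only [C1, dd, map_add, map_sub, Prod.fst_add, Prod.fst_sub, eT_act1 hρ]
  · refine Eq.trans ?_ (Phi_dd (k := k) hp5 hp o x (fun g => (eT h2 (b (sg g))).2))
    change Phi _ _ _ _ = _
    congr 1; funext g h
    simp only [C2, dd, map_add, map_sub, Prod.snd_add, Prod.snd_sub, eT_act2 hρ, sg_sg, map_mul]

lemma Psi_ker (hρ : Cpt ρ) (hp5 : 5 ≤ p) (hp : p.Prime) (h2 : (2 : k) ≠ 0) {o x : ι} (hx : x ≠ o)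
    {c : GL ι k × GL ι k → TT k ι} (hc : CT ρ c) (h : Psi p h2 o x c = 0) :
    ∃ b : GL ι k → TT k ι, c = fun q => ρ q.1 (b q.2) - b (q.1 * q.2) + b q.1 := by
  obtain ⟨b1, h1⟩ := H2Phi hp5 hp hx (hc.c1 hρ h2) (congrArg Prod.fst h)
  obtain ⟨b2, h2'⟩ := H2Phi hp5 hp hx (hc.c2 hρ h2) (congrArg Prod.snd h)
  refine ⟨fun g => (eT h2).symm (b1 g, b2 (sg g)), ?_⟩
  funext ⟨g, h⟩
  apply (eT h2).injective
  rw [map_add, map_sub]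
  refine Prod.ext ?_ ?_
  · rw [Prod.fst_add, Prod.fst_sub, eT_act1 hρ]
    simp only [LinearEquiv.apply_symm_apply]
    exact h1 g h
  · rw [Prod.snd_add, Prod.snd_sub, eT_act2 hρ]
    simp only [LinearEquiv.apply_symm_apply, map_mul]
    have := h2' (sg g) (sg h)
    simp only [C2, sg_sg] at this
    exact this

lemma Psi_surj (hρ : Cpt ρ) (hp : p.Prime) (h2 : (2 : k) ≠ 0) {o x : ι} (hx : x ≠ o)
    (a b : k) : ∃ c, CT ρ c ∧ Psi p h2 o x c = (a, b) := by
  haveI : Fact p.Prime := ⟨hp⟩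
  refine ⟨fun q => (eT h2).symm ((-2 : k)⁻¹ • a • cM p q.1 q.2, (-2 : k)⁻¹ • b • cM p (sg q.1) (sg q.2)), ?_, ?_⟩
  · intro g h j
    apply (eT h2).injective
    have cc := cM_coc (k := k) (ι := ι) (p := p)
    rw [map_add, map_add]
    refine Prod.ext ?_ ?_
    · rw [Prod.fst_add, Prod.fst_add, eT_act1 hρ]
      simp only [LinearEquiv.apply_symm_apply, map_smul]
      rw [← smul_add, ← smul_add, ← smul_add, ← smul_add, cc]
    · rw [Prod.snd_add, Prod.snd_add, eT_act2 hρ]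
      simp only [LinearEquiv.apply_symm_apply, map_smul]
      rw [← smul_add, ← smul_add, ← smul_add, ← smul_add, map_mul, map_mul, cc]
  · have h2' : (-2 : k) ≠ 0 := neg_ne_zero.mpr h2
    refine Prod.ext ?_ ?_
    · change Phi o x p (fun g h => C1 h2 _ g h) = a
      simp only [C1, LinearEquiv.apply_symm_apply]
      rw [Phi_smul, Phi_smul]
      change _ * (_ * Phi o x p (cM p)) = _
      rw [Phi_cM hx]
      field_simp
    · change Phi o x p (fun g h => C2 h2 _ g h) = b
      simp only [C2, LinearEquiv.apply_symm_apply, sg_sg]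
      rw [Phi_smul, Phi_smul]
      change _ * (_ * Phi o x p (cM p)) = _
      rw [Phi_cM hx]
      field_simp

lemma H2_fin (hρ : Cpt ρ) (hp5 : 5 ≤ p) (hp : p.Prime) {o x : ι} (hx : x ≠ o) :
    Module.finrank k (groupCohomology (Rep.of ρ) 2) = 2 := by
  have h2 : (2 : k) ≠ 0 := two_ne hp5
  let A : Rep k (GL ι k) := Rep.of ρ
  let π : cocycles₂ A →ₗ[k] groupCohomology A 2 := (H2π A).hom
  let Ψ : cocycles₂ A →ₗ[k] k × k := (Psi p h2 o x).comp (cocycles₂ A).subtype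
  have hct : ∀ c : cocycles₂ A, CT ρ c.1 := fun c => (mem_cocycles₂_iff c.1).1 c.2
  have hπ : Function.Surjective π := (ModuleCat.epi_iff_surjective _).1 inferInstance
  have hΨ : Function.Surjective Ψ := by
    rintro ⟨a, b⟩
    obtain ⟨c, h1, h3⟩ := Psi_surj hρ hp h2 hx a b
    exact ⟨⟨c, (mem_cocycles₂_iff (A := A) c).2 h1⟩, h3⟩
  have hk : LinearMap.ker π = LinearMap.ker Ψ := by
    ext c
    rw [LinearMap.mem_ker, LinearMap.mem_ker]
    refine (H2π_eq_zero_iff c).trans ⟨?_, ?_⟩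
    · rintro ⟨b, hb⟩
      have := Psi_cob hρ hp5 hp h2 o x b
      have e : c.1 = fun q => ρ q.1 (b q.2) - b (q.1 * q.2) + b q.1 := hb.symm
      change Psi p h2 o x c.1 = 0
      rw [e]; exact this
    · intro h
      obtain ⟨b, hb⟩ := Psi_ker hρ hp5 hp h2 hx (hct c) h
      exact ⟨b, hb.symm⟩
  let e : groupCohomology A 2 ≃ₗ[k] k × k :=
    (LinearMap.quotKerEquivOfSurjective π hπ).symm ≪≫ₗ Submodule.quotEquivOfEq _ _ hk ≪≫ₗ
      LinearMap.quotKerEquivOfSurjective Ψ hΨ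
  exact e.finrank_eq.trans (by simp)

lemma H1_fin (hρ : Cpt ρ) (hp5 : 5 ≤ p) (o : ι) : Subsingleton (groupCohomology (Rep.of ρ) 1) := by
  refine ⟨fun a b => ?_⟩
  have : ∀ a : H1 (Rep.of ρ), a = 0 := by
    intro a
    induction a using H1_induction_on with
    | h c =>
      rw [H1π_eq_zero_iff]
      obtain ⟨t, ht⟩ := fin1 (p := p) hρ hp5 o c.1 (fun g h => (mem_cocycles₁_iff c.1).1 c.2 g h)
      exact ⟨t, funext ht⟩
  rw [this a, this b]

lemma H0_fin (hρ : Cpt ρ) (hp5 : 5 ≤ p) (o : ι) : Subsingleton (groupCohomology (Rep.of ρ) 0) := by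
  have : Subsingleton ((Rep.of ρ).ρ.invariants) := by
    refine ⟨fun a b => Subtype.ext ?_⟩
    rw [fin0 (p := p) hρ hp5 o a.1 a.2, fin0 (p := p) hρ hp5 o b.1 b.2]
  exact (H0Iso (Rep.of ρ)).toLinearEquiv.toEquiv.subsingleton

lemma cpt_alt (n : ℕ) : Cpt (altPowRep k (Matrix (Fin n) (Fin n) k) 2 (glConj k n)) := by
  intro g x y
  change Submodule.Quotient.mk (tpowRep k _ 2 (glConj k n) g (PiTensorProduct.tprod k ![x, y])) = _
  rw [tpowRep_apply, wd]
  congr 2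
  funext i
  fin_cases i <;> rfl

end Fin
end GLC


/-- Low-degree cohomology of `GL(n,k)` with coefficients in `Λ²(gl_n)`,
for `k` finite of characteristic `p ≥ 5` and `n ≥ 2`. -/
theorem gl_cohomology_ext2_low_degrees
    (k : Type) [Field k] [Fintype k] (p : ℕ) [CharP k p] (hp : 5 ≤ p)
    (n : ℕ) (hn : 2 ≤ n) :
    Subsingleton (groupCohomology (Rep.of (altPowRep k (Matrix (Fin n) (Fin n) k) 2 (glConj k n))) 0) ∧
    Subsingleton (groupCohomology (Rep.of (altPowRep k (Matrix (Fin n) (Fin n) k) 2 (glConj k n))) 1) ∧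
    Module.finrank k (groupCohomology (Rep.of (altPowRep k (Matrix (Fin n) (Fin n) k) 2 (glConj k n))) 2) = 2 := by
  classical
  have hpp : p.Prime := (CharP.char_is_prime_or_zero k p).resolve_right (by omega)
  have hx : (⟨1, by omega⟩ : Fin n) ≠ ⟨0, by omega⟩ := by simp
  exact ⟨GLC.H0_fin (p := p) (GLC.cpt_alt n) hp ⟨0, by omega⟩,
    GLC.H1_fin (p := p) (GLC.cpt_alt n) hp ⟨0, by omega⟩, GLC.H2_fin (GLC.cpt_alt n) hp hpp hx⟩
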